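/- arXiv:2309.14312 — 4 statements merged into one kernel-verified Lean document; each statement's English description precedes it below -/
import Mathlib

section
/- (Poincaré duality for Chow rings of matroids) For every finite simple matroid M of rank r+1 and every integer k with 0 ≤ k ≤ r, the bilinear pairing A^k × A^{r−k} → ℤ given by (a, b) ↦ deg(a·b) is perfect; that is, the map A^{r−k} → Hom_ℤ(A^k, ℤ) sending b to the functional a ↦ deg(a·b) is a ℤ-module isomorphism. -/
open Finset

/-- A finite simple matroid, presented by its lattice of flats and rank function. -/
structure SimpleFlatMatroid (E : Type*) [Fintype E] [DecidableEq E] where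
  /-- the collection of flats -/
  flats : Finset (Finset E)
  /-- the rank function -/
  rk : Finset E → ℕ
  /-- (F1): the ground set is a flat -/
  ground_mem : (Finset.univ : Finset E) ∈ flats
  /-- (F2): flats are closed under intersection -/
  inter_mem : ∀ F ∈ flats, ∀ F' ∈ flats, F ∩ F' ∈ flats
  /-- (F3): for a flat `F` and `i ∉ F` there is a unique flat containing `i` covering `F` -/
  cover_axiom : ∀ F ∈ flats, ∀ i : E, i ∉ F →
    ∃! F' : Finset E, F' ∈ flats ∧ i ∈ F' ∧ F ⊂ F' ∧
      ¬ ∃ F'' ∈ flats, F ⊂ F'' ∧ F'' ⊂ F'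
  /-- simplicity: no loops, i.e. `∅` is a flat -/
  empty_mem : (∅ : Finset E) ∈ flats
  /-- simplicity: no parallel elements, i.e. all singletons are flats -/
  singleton_mem : ∀ i : E, ({i} : Finset E) ∈ flats
  /-- normalization of the rank function -/
  rk_empty : rk ∅ = 0
  /-- the rank function increases by one along covers of flats -/
  rk_cover : ∀ F ∈ flats, ∀ F' ∈ flats, F ⊂ F' →
    (¬ ∃ F'' ∈ flats, F ⊂ F'' ∧ F'' ⊂ F') → rk F' = rk F + 1

namespace SimpleFlatMatroid

variable {E : Type*} [Fintype E] [DecidableEq E]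

/-- We encode a (squarefree-or-not) monomial in the variables `x_F` as the function
sending each `F` to the exponent of `x_F`.  `prevFlat m F` is the union of all flats
in the support of `m` strictly contained in `F`; when the support of `m` is a chain
this is the predecessor of `F` in the support (or `∅` if there is none). -/
def prevFlat (m : Finset E → ℕ) (F : Finset E) : Finset E :=
  Finset.univ.sup fun F' => if m F' ≠ 0 ∧ F' ⊂ F then F' else ∅

/-- The total degree of a monomial. -/
def deg (m : Finset E → ℕ) : ℕ := ∑ F : Finset E, m F

variable (M : SimpleFlatMatroid E)

/-- `m` is an FY-monomial: its support is a chain `F₁ ⊊ ⋯ ⊊ F_ℓ` of nonempty flats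
with `m Fᵢ ≤ rk(Fᵢ) - rk(Fᵢ₋₁) - 1` for all `i` (with `F₀ := ∅`). -/
def IsFY (m : Finset E → ℕ) : Prop :=
  (∀ F : Finset E, m F ≠ 0 → F ∈ M.flats ∧ F ≠ ∅) ∧
  (∀ F F' : Finset E, m F ≠ 0 → m F' ≠ 0 → F ⊆ F' ∨ F' ⊆ F) ∧
  (∀ F : Finset E, m F ≠ 0 → m F + M.rk (prevFlat m F) + 1 ≤ M.rk F)

/-- The set `FY^k` of FY-monomials of total degree `k`, as a type. -/
abbrev FYk (k : ℕ) : Type _ := {m : Finset E → ℕ // M.IsFY m ∧ deg m = k}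

/-- `g` is an automorphism of the matroid: a permutation of the ground set carrying
flats to flats. -/
def IsAut (g : Equiv.Perm E) : Prop := ∀ F ∈ M.flats, F.image g ∈ M.flats

/-- The action of a permutation `g` on monomials:
`g ⋅ (x_{F₁}^{m₁} ⋯ x_{F_ℓ}^{m_ℓ}) = x_{g F₁}^{m₁} ⋯ x_{g F_ℓ}^{m_ℓ}`. -/
def mact (g : Equiv.Perm E) (m : Finset E → ℕ) : Finset E → ℕ :=
  fun F => m (F.image (g⁻¹ : Equiv.Perm E))

end SimpleFlatMatroid

namespace SimpleFlatMatroid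

variable {E : Type*} [Fintype E] [DecidableEq E] (M : SimpleFlatMatroid E)

/-- The index type of the variables of the Chow ring: nonempty flats of `M`. -/
abbrev FlatVar : Type _ := {F : Finset E // F ∈ M.flats ∧ F ≠ ∅}

/-- The polynomial ring `S = ℤ[x_F : ∅ ≠ F ∈ 𝓕]`. -/
abbrev ChowPoly : Type _ := MvPolynomial (FlatVar M) ℤ

/-- The ideal `I + J`, where `I` is generated by the products `x_F x_{F'}` over
incomparable pairs of nonempty flats, and `J` is generated by the linear forms
`∑_{F ∋ a} x_F`, one for each element `a` of the ground set. -/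
noncomputable def chowIdeal : Ideal (ChowPoly M) :=
  Ideal.span
    ({p | ∃ F F' : FlatVar M, ¬ F.1 ⊆ F'.1 ∧ ¬ F'.1 ⊆ F.1 ∧
        p = MvPolynomial.X F * MvPolynomial.X F'} ∪
     {p | ∃ a : E, p = ∑ F : FlatVar M, if a ∈ F.1 then MvPolynomial.X F else 0})

/-- The Chow ring `A(M) = S/(I+J)`. -/
abbrev ChowRing : Type _ := ChowPoly M ⧸ chowIdeal M

/-- The quotient map `S → A(M)`. -/
noncomputable def chowMk : ChowPoly M →ₐ[ℤ] ChowRing M :=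
  Ideal.Quotient.mkₐ ℤ (chowIdeal M)

/-- The degree-`k` graded component `A^k` of the Chow ring, i.e. the image of the
homogeneous degree-`k` polynomials under the quotient map. -/
noncomputable def chowComp (k : ℕ) : Submodule ℤ (ChowRing M) :=
  (MvPolynomial.homogeneousSubmodule (FlatVar M) ℤ k).map (chowMk M).toLinearMap

/-- The polynomial `x_{F₁}^{m₁} ⋯ x_{F_ℓ}^{m_ℓ}` in `S` corresponding to a monomial
given as an exponent function on flats. -/
noncomputable def FYpoly (m : Finset E → ℕ) : ChowPoly M :=
  MvPolynomial.monomial (Finsupp.equivFunOnFinite.symm fun F : FlatVar M => m F.1) 1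

/-- The action of an automorphism `g` on the polynomial ring `S`, by `x_F ↦ x_{g F}`. -/
noncomputable def autRename (g : Equiv.Perm E) (hg : M.IsAut g) :
    ChowPoly M →ₐ[ℤ] ChowPoly M :=
  MvPolynomial.rename fun F : FlatVar M =>
    (⟨F.1.image g, hg F.1 F.2.1, by
        simpa [Finset.image_eq_empty] using F.2.2⟩ : FlatVar M)

/-- The class in `A^k` of a homogeneous polynomial of degree `k`. -/
noncomputable def clsOf {k : ℕ} (p : ChowPoly M)
    (hp : p ∈ MvPolynomial.homogeneousSubmodule (FlatVar M) ℤ k) : chowComp M k :=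
  ⟨chowMk M p, Submodule.mem_map_of_mem hp⟩


/-- The variable `x_E` corresponding to the ground set. -/
noncomputable def xE [Nonempty E] : ChowPoly M :=
  MvPolynomial.X (⟨Finset.univ, M.ground_mem, Finset.univ_nonempty.ne_empty⟩ : FlatVar M)


/-- Renaming variables along an automorphism preserves homogeneity. -/
theorem autRename_mem_homogeneousSubmodule {k : ℕ} (g : Equiv.Perm E) (hg : M.IsAut g)
    {p : ChowPoly M} (hp : p ∈ MvPolynomial.homogeneousSubmodule (FlatVar M) ℤ k) :
    autRename M g hg p ∈ MvPolynomial.homogeneousSubmodule (FlatVar M) ℤ k := by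
  rw [MvPolynomial.mem_homogeneousSubmodule] at hp ⊢
  exact hp.rename_isHomogeneous

end SimpleFlatMatroid

namespace ChowPD

open SimpleFlatMatroid

variable {E : Type*} [Fintype E] [DecidableEq E]

/-! ### Rank facts -/

/-- A flat containing `F` and `i` contains the cover of `F` through `i`. -/
theorem exists_cover (M : SimpleFlatMatroid E) {F : Finset E} (hF : F ∈ M.flats) {i : E}
    (hi : i ∉ F) : ∃ F' ∈ M.flats, i ∈ F' ∧ F ⊂ F' ∧ M.rk F' = M.rk F + 1 ∧
      ∀ H ∈ M.flats, F ⊆ H → i ∈ H → F' ⊆ H := by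
  obtain ⟨F', ⟨h1, h2, h3, h4⟩, -⟩ := SimpleFlatMatroid.cover_axiom M F hF i hi
  refine ⟨F', h1, h2, h3, M.rk_cover F hF F' h1 h3 h4, fun H hH hFH hiH => ?_⟩
  by_contra hcon
  apply h4
  refine ⟨F' ∩ H, M.inter_mem _ h1 _ hH, ?_, ?_⟩
  · refine ⟨Finset.subset_inter h3.1 hFH, fun h => hi (h (Finset.mem_inter.2 ⟨h2, hiH⟩))⟩
  · exact ⟨Finset.inter_subset_left, fun h => hcon (h.trans Finset.inter_subset_right)⟩

/-- If `F ⊆ G` are flats, then `G` is generated over `F` by at most `rk G - rk F` elements. -/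
theorem exists_gen (M : SimpleFlatMatroid E) : ∀ (n : ℕ) (F G : Finset E), F ∈ M.flats →
    G ∈ M.flats → F ⊆ G → (G \ F).card ≤ n →
    ∃ S : Finset E, S ⊆ G ∧ M.rk F + S.card ≤ M.rk G ∧
      ∀ H ∈ M.flats, F ∪ S ⊆ H → G ⊆ H := by
  intro n
  induction n with
  | zero =>
    intro F G hF hG hFG hc
    have : G ⊆ F := by
      rw [← Finset.sdiff_eq_empty_iff_subset, ← Finset.card_eq_zero]; omega
    have h : F = G := hFG.antisymm this
    subst h
    exact ⟨∅, by simp, by simp, fun H _ h => by simpa using h⟩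
  | succ n ih =>
    intro F G hF hG hFG hc
    by_cases h : G ⊆ F
    · have h : F = G := hFG.antisymm h
      subst h
      exact ⟨∅, by simp, by simp, fun H _ h => by simpa using h⟩
    · obtain ⟨i, hiG, hiF⟩ := Finset.not_subset.1 h
      obtain ⟨F', hF', hiF', hFF', hrk, hmin⟩ := exists_cover M hF hiF
      have hF'G : F' ⊆ G := hmin G hG hFG hiG
      have hlt : (G \ F').card < (G \ F).card := by
        apply Finset.card_lt_card
        refine ⟨Finset.sdiff_subset_sdiff le_rfl hFF'.1, fun hh => ?_⟩
        have := hh (Finset.mem_sdiff.2 ⟨hiG, hiF⟩)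
        exact (Finset.mem_sdiff.1 this).2 hiF'
      obtain ⟨S, hSG, hSc, hS⟩ := ih F' G hF' hG hF'G (by omega)
      refine ⟨insert i S, ?_, ?_, ?_⟩
      · intro j hj
        rcases Finset.mem_insert.1 hj with rfl | hj
        · exact hiG
        · exact hSG hj
      · have := Finset.card_insert_le i S
        omega
      · intro H hH hsub
        apply hS H hH
        have h1 : F' ⊆ H := hmin H hH (Finset.subset_union_left.trans hsub)
          (hsub (by simp))
        refine Finset.union_subset h1 fun j hj => hsub (by simp [hj])

theorem rk_lt (M : SimpleFlatMatroid E) {F G : Finset E} (hF : F ∈ M.flats)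
    (hG : G ∈ M.flats) (h : F ⊂ G) : M.rk F < M.rk G := by
  obtain ⟨S, -, h2, h3⟩ := exists_gen M _ F G hF hG h.1 le_rfl
  rcases Finset.eq_empty_or_nonempty S with rfl | hS
  · exact absurd (h3 F hF (by simp)) h.2
  · have := hS.card_pos
    omega

/-! ### The basic relations, in an abstract commutative ring -/

variable {M : SimpleFlatMatroid E} {A : Type*} [CommRing A]

/-- Elements `x F` of a ring satisfying the defining relations of the Chow ring. -/
structure Rel (M : SimpleFlatMatroid E) (x : FlatVar M → A) : Prop where
  inc : ∀ F G : FlatVar M, ¬ F ≤ G → ¬ G ≤ F → x F * x G = 0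
  lin : ∀ a : E, ∑ F : FlatVar M with a ∈ F.1, x F = 0

theorem mul_pow_congr {a b c : A} (h : a * b = a * c) (n : ℕ) : a * b ^ n = a * c ^ n := by
  induction n with
  | zero => simp
  | succ n ih =>
    calc a * b ^ (n + 1) = (a * b ^ n) * b := by ring
      _ = (a * b) * c ^ n := by rw [ih]; ring
      _ = a * c ^ (n + 1) := by rw [h]; ring

theorem rel_aux {x : FlatVar M → A} (hx : Rel M x) : ∀ (n : ℕ) (S F : Finset E) (y : A),
    (∀ H : FlatVar M, ¬ F ⊆ H.1 → ¬ H.1 ⊆ F → y * x H = 0) → ¬ S ⊆ F → S.card ≤ n →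
    y * (∑ H : FlatVar M with F ∪ S ⊆ H.1, x H) ^ n = 0 := by
  intro n
  induction n with
  | zero =>
    intro S F y _ hS hc
    have : S = ∅ := Finset.card_eq_zero.1 (by omega)
    subst this
    exact absurd (Finset.empty_subset F) hS
  | succ n ih =>
    intro S F y hy hS hc
    obtain ⟨a, haS, haF⟩ := Finset.not_subset.1 hS
    set h := ∑ H : FlatVar M with F ∪ S ⊆ H.1, x H with hh
    have hsplit : h + ∑ H : FlatVar M with a ∈ H.1 ∧ ¬ F ∪ S ⊆ H.1, x H = 0 := by
      rw [← hx.lin a, hh, ← Finset.sum_filter_add_sum_filter_not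
        (Finset.univ.filter fun H : FlatVar M => a ∈ H.1) (fun H => F ∪ S ⊆ H.1),
        Finset.filter_filter, Finset.filter_filter]
      congr 1
      apply Finset.sum_congr _ (fun _ _ => rfl)
      ext H
      simp only [Finset.mem_filter, Finset.mem_univ, true_and]
      exact ⟨fun hH => ⟨hH (by simp [haS]), hH⟩, fun hH => hH.2⟩
    have hh' : h = - ∑ H : FlatVar M with a ∈ H.1 ∧ ¬ F ∪ S ⊆ H.1, x H :=
      eq_neg_of_add_eq_zero_left hsplit
    have : y * h ^ (n + 1) = - ∑ H : FlatVar M with a ∈ H.1 ∧ ¬ F ∪ S ⊆ H.1,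
        y * (x H * h ^ n) := by
      rw [pow_succ', ← mul_assoc]
      nth_rewrite 1 [hh']
      rw [mul_neg, neg_mul, Finset.mul_sum, Finset.sum_mul]
      simp only [mul_assoc]
    rw [this, neg_eq_zero]
    apply Finset.sum_eq_zero
    intro H hH
    simp only [Finset.mem_filter, Finset.mem_univ, true_and] at hH
    obtain ⟨haH, hnH⟩ := hH
    by_cases hFH : F ⊆ H.1
    · have key : x H * h = x H * ∑ K : FlatVar M with H.1 ∪ S.erase a ⊆ K.1, x K := by
        rw [hh, Finset.mul_sum, Finset.mul_sum, Finset.sum_filter, Finset.sum_filter]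
        apply Finset.sum_congr rfl
        intro K _
        by_cases hK : H.1 ∪ S.erase a ⊆ K.1
        · have : F ∪ S ⊆ K.1 := by
            refine Finset.union_subset (hFH.trans (Finset.subset_union_left.trans hK)) ?_
            intro j hj
            by_cases hja : j = a
            · subst hja
              exact hK (Finset.mem_union_left _ haH)
            · exact hK (Finset.mem_union_right _ (Finset.mem_erase.2 ⟨hja, hj⟩))
          simp [hK, this]
        · rw [if_neg hK]
          split_ifs with hK2
          · apply hx.inc
            · intro hHK
              apply hK
              exact Finset.union_subset hHK ((Finset.erase_subset _ _).trans
                (Finset.subset_union_right.trans hK2))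
            · intro hKH
              exact hnH (hK2.trans hKH)
          · rfl
      rw [mul_pow_congr key]
      rw [ih (S.erase a) H.1 (x H), mul_zero]
      · intro K h1 h2
        exact hx.inc _ _ h1 h2
      · intro hsub
        apply hnH
        refine Finset.union_subset hFH fun j hj => ?_
        by_cases hja : j = a
        · exact hja ▸ haH
        · exact hsub (Finset.mem_erase.2 ⟨hja, hj⟩)
      · rw [Finset.card_erase_of_mem haS]; omega
    · rw [← mul_assoc, hy H hFH (fun hHF => haF (hHF haH)), zero_mul]

/-- The sum of the variables strictly above `G`. -/
def up (x : FlatVar M → A) (G : FlatVar M) : A := ∑ H : FlatVar M with G < H, x H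

theorem rel_main {x : FlatVar M → A} (hx : Rel M x) {F : Finset E} (hF : F ∈ M.flats)
    (G : FlatVar M) (hFG : F ⊂ G.1) (n : ℕ) (hn : M.rk G.1 ≤ M.rk F + n) (y : A)
    (hy : ∀ H : FlatVar M, ¬ F ⊆ H.1 → ¬ H.1 ⊆ F → y * x H = 0) :
    y * (x G + up x G) ^ n = 0 := by
  obtain ⟨S, hSG, h2, h3⟩ := exists_gen M _ F G.1 hF G.2.1 hFG.1 le_rfl
  have hS : ¬ S ⊆ F := fun h => hFG.2 (h3 F hF (Finset.union_subset le_rfl h))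
  have := rel_aux hx n S F y hy hS (by omega)
  rw [← this]
  congr 2
  have h1 : (Finset.univ.filter fun H : FlatVar M => F ∪ S ⊆ H.1) =
      insert G (Finset.univ.filter fun H : FlatVar M => G < H) := by
    ext H
    simp only [Finset.mem_filter, Finset.mem_univ, true_and, Finset.mem_insert]
    constructor
    · intro h
      have : G ≤ H := h3 H.1 H.2.1 h
      rcases eq_or_lt_of_le this with h | h
      · exact Or.inl h.symm
      · exact Or.inr h
    · intro h
      have : G ≤ H := by
        rcases h with h | h
        · exact h.symm.le
        · exact h.le
      exact (Finset.union_subset hFG.1 hSG).trans this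
  rw [h1, Finset.sum_insert (by simp)]
  rfl

/-! ### Monomials as multisets -/

/-- The monomial of a multiset of flats. -/
def mon (x : FlatVar M → A) (s : Multiset (FlatVar M)) : A := (s.map x).prod

open Classical in
/-- Number of elements of a multiset satisfying a predicate. -/
noncomputable def cnt {V : Type*} (p : V → Prop) (s : Multiset V) : ℕ := s.countP p

/-- Weight of a monomial. -/
def wt (s : Multiset (FlatVar M)) : ℕ := (s.map fun v => v.1.card).sum

/-- The support is a chain. -/
def Ch (s : Multiset (FlatVar M)) : Prop := ∀ a ∈ s, ∀ b ∈ s, a ≤ b ∨ b ≤ a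

section cnt
variable {V : Type*} (p : V → Prop)

theorem cnt_add (s t : Multiset V) : cnt p (s + t) = cnt p s + cnt p t :=
  by classical exact Multiset.countP_add _ _ _

theorem cnt_all {s : Multiset V} (h : ∀ v ∈ s, p v) : cnt p s = s.card :=
  by classical exact Multiset.countP_eq_card.2 h

theorem cnt_none {s : Multiset V} (h : ∀ v ∈ s, ¬ p v) : cnt p s = 0 :=
  by classical exact Multiset.countP_eq_zero.2 h

theorem of_cnt_zero {s : Multiset V} (h : cnt p s = 0) : ∀ v ∈ s, ¬ p v := by
  classical exact Multiset.countP_eq_zero.1 h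

theorem cnt_le (s : Multiset V) : cnt p s ≤ s.card := by
  classical exact Multiset.countP_le_card _ _

theorem cnt_rep_pos (n : ℕ) {v : V} (h : p v) : cnt p (Multiset.replicate n v) = n := by
  rw [cnt_all, Multiset.card_replicate]
  intro w hw
  rwa [Multiset.eq_of_mem_replicate hw]

theorem cnt_rep_neg (n : ℕ) {v : V} (h : ¬ p v) : cnt p (Multiset.replicate n v) = 0 := by
  rw [cnt_none]
  intro w hw
  rwa [Multiset.eq_of_mem_replicate hw]

theorem cnt_congr {p q : V → Prop} {s : Multiset V} (h : ∀ v ∈ s, p v ↔ q v) :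
    cnt p s = cnt q s := by
  classical
  exact Multiset.countP_congr rfl (fun v hv => by simpa using h v hv)

theorem cnt_mono {p q : V → Prop} {s : Multiset V} (h : ∀ v ∈ s, p v → q v) :
    cnt p s ≤ cnt q s := by
  induction s using Multiset.induction with
  | empty => simp [cnt]
  | cons a s ih =>
    have := ih (fun v hv => h v (Multiset.mem_cons_of_mem hv))
    have h2 := h a (Multiset.mem_cons_self a s)
    unfold cnt at *
    rw [Multiset.countP_cons, Multiset.countP_cons]
    split_ifs with h3 h4 h4
    · omega
    · exact absurd (h2 h3) h4
    · omega
    · omega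

theorem cnt_not (s : Multiset V) : cnt p s + cnt (fun v => ¬ p v) s = s.card := by
  classical
  unfold cnt
  rw [Multiset.card_eq_countP_add_countP p s]
  congr

end cnt

theorem wt_add (s t : Multiset (FlatVar M)) : wt (s + t) = wt s + wt t := by
  simp [wt]

theorem wt_rep (n : ℕ) (v : FlatVar M) : wt (Multiset.replicate n v) = n * v.1.card := by
  simp [wt]

theorem wt_le (s : Multiset (FlatVar M)) : wt s ≤ s.card * Fintype.card E := by
  induction s using Multiset.induction with
  | empty => simp [wt]
  | cons a s ih =>
    simp only [wt, Multiset.map_cons, Multiset.sum_cons, Multiset.card_cons] at *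
    have := Finset.card_le_univ a.1
    rw [add_mul]; omega

theorem wt_ge {n : ℕ} (s : Multiset (FlatVar M)) (h : ∀ v ∈ s, n ≤ v.1.card) :
    s.card * n ≤ wt s := by
  induction s using Multiset.induction with
  | empty => simp [wt]
  | cons a s ih =>
    have h1 := ih (fun v hv => h v (Multiset.mem_cons_of_mem hv))
    have h2 := h a (Multiset.mem_cons_self a s)
    simp only [wt, Multiset.map_cons, Multiset.sum_cons, Multiset.card_cons] at *
    rw [add_mul]; omega

variable {x : FlatVar M → A}

theorem mon_add (s t : Multiset (FlatVar M)) : mon x (s + t) = mon x s * mon x t := by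
  simp [mon]

theorem mon_rep (n : ℕ) (v : FlatVar M) : mon x (Multiset.replicate n v) = x v ^ n := by
  simp [mon]

theorem mon_cons (v : FlatVar M) (s : Multiset (FlatVar M)) :
    mon x (v ::ₘ s) = x v * mon x s := by
  simp [mon]

theorem mon_mul_zero (hx : Rel M x) {s : Multiset (FlatVar M)} {F : FlatVar M} (hF : F ∈ s)
    (H : FlatVar M) (h1 : ¬ F ≤ H) (h2 : ¬ H ≤ F) : mon x s * x H = 0 := by
  obtain ⟨t, rfl⟩ := Multiset.exists_cons_of_mem hF
  rw [mon_cons, mul_right_comm, hx.inc F H h1 h2, zero_mul]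

theorem mon_not_ch (hx : Rel M x) {s : Multiset (FlatVar M)} (h : ¬ Ch s) : mon x s = 0 := by
  unfold Ch at h
  push Not at h
  obtain ⟨a, ha, b, hb, h1, h2⟩ := h
  obtain ⟨t, rfl⟩ := Multiset.exists_cons_of_mem hb
  rw [mon_cons, mul_comm]
  rcases Multiset.mem_cons.1 ha with rfl | ha
  · exact absurd le_rfl h1
  · exact mon_mul_zero hx ha b h1 h2

theorem mul_span {S T : Set A} {c z : A} (hz : z ∈ Submodule.span ℤ S)
    (h : ∀ s ∈ S, c * s ∈ Submodule.span ℤ T) : c * z ∈ Submodule.span ℤ T := by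
  induction hz using Submodule.span_induction with
  | mem y hy => exact h y hy
  | zero => simp
  | add y z _ _ h1 h2 => rw [mul_add]; exact Submodule.add_mem _ h1 h2
  | smul n y _ h1 => rw [mul_smul_comm]; exact Submodule.smul_mem _ _ h1

theorem mul_span_zero {S : Set A} {c z : A} (hz : z ∈ Submodule.span ℤ S)
    (h : ∀ s ∈ S, c * s = 0) : c * z = 0 := by
  have := mul_span (T := ∅) hz (c := c) (fun s hs => by rw [h s hs]; simp)
  simpa using this

theorem up_pow (G : FlatVar M) (q : ℕ) : up x G ^ q ∈
    Submodule.span ℤ {z | ∃ u : Multiset (FlatVar M), u.card = q ∧ (∀ v ∈ u, G < v) ∧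
      z = mon x u} := by
  induction q with
  | zero => exact Submodule.subset_span ⟨0, by simp, by simp, by simp [mon]⟩
  | succ q ih =>
    rw [pow_succ']
    refine mul_span ih ?_
    rintro _ ⟨u, hu, hG, rfl⟩
    rw [up, Finset.sum_mul]
    refine Submodule.sum_mem _ fun H hH => ?_
    simp only [Finset.mem_filter, Finset.mem_univ, true_and] at hH
    refine Submodule.subset_span ⟨H ::ₘ u, by simp [hu], ?_, (mon_cons H u).symm⟩
    intro v hv
    rcases Multiset.mem_cons.1 hv with rfl | hv
    · exact hH
    · exact hG v hv

/-- `F` is either empty or in the support of `s`. -/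
def Base (s : Multiset (FlatVar M)) (F : Finset E) : Prop := F = ∅ ∨ ∃ f ∈ s, f.1 = F

theorem Base.mem {s : Multiset (FlatVar M)} {F : Finset E} (h : Base s F) : F ∈ M.flats := by
  rcases h with rfl | ⟨f, -, rfl⟩
  · exact M.empty_mem
  · exact f.2.1

theorem Base.mul_zero (hx : Rel M x) {s : Multiset (FlatVar M)} {F : Finset E}
    (h : Base s F) (H : FlatVar M) (h1 : ¬ F ⊆ H.1) (h2 : ¬ H.1 ⊆ F) : mon x s * x H = 0 := by
  rcases h with rfl | ⟨f, hf, rfl⟩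
  · exact absurd (Finset.empty_subset _) h1
  · exact mon_mul_zero hx hf H h1 h2

/-- Expansion of `x_G ^ n * mon t`. -/
theorem expand (hx : Rel M x) {t : Multiset (FlatVar M)} {F : Finset E} (hF : Base t F)
    (G : FlatVar M) (hFG : F ⊂ G.1) (n : ℕ) (hn : M.rk G.1 ≤ M.rk F + n) :
    mon x t * x G ^ n = - ∑ m ∈ Finset.range n,
      mon x t * (x G ^ m * up x G ^ (n - m) * (n.choose m : A)) := by
  have h := rel_main hx hF.mem G hFG n hn (mon x t) (fun H => hF.mul_zero hx H)
  rw [add_pow, Finset.sum_range_succ, mul_add, Finset.mul_sum] at h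
  simp only [Nat.sub_self, pow_zero, mul_one, Nat.choose_self, Nat.cast_one] at h
  exact eq_neg_of_add_eq_zero_right h

theorem reduce_core (hx : Rel M x) {t : Multiset (FlatVar M)} {F : Finset E} (hF : Base t F)
    (G : FlatVar M) (hFG : F ⊂ G.1) (n : ℕ) (hn : M.rk G.1 ≤ M.rk F + n) :
    mon x (t + Multiset.replicate n G) ∈ Submodule.span ℤ {z | ∃ (p : ℕ)
      (u : Multiset (FlatVar M)), p < n ∧ p + u.card = n ∧ (∀ v ∈ u, G < v) ∧
      z = mon x (t + Multiset.replicate p G + u)} := by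
  rw [mon_add, mon_rep, expand hx hF G hFG n hn]
  refine Submodule.neg_mem _ (Submodule.sum_mem _ fun m hm => ?_)
  rw [Finset.mem_range] at hm
  rw [show mon x t * (x G ^ m * up x G ^ (n - m) * (n.choose m : A)) =
    (n.choose m : ℕ) • ((mon x t * x G ^ m) * up x G ^ (n - m)) by rw [nsmul_eq_mul]; ring]
  refine Submodule.smul_of_tower_mem _ _ (mul_span (up_pow G (n - m)) ?_)
  rintro _ ⟨u, hu, hu2, rfl⟩
  refine Submodule.subset_span ⟨m, u, hm, by omega, hu2, ?_⟩
  rw [mon_add, mon_add, mon_rep]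

theorem reduce (hx : Rel M x) {s : Multiset (FlatVar M)} {F : Finset E} (hF : Base s F)
    (G : FlatVar M) (hFG : F ⊂ G.1) (hn : M.rk G.1 ≤ M.rk F + cnt (· = G) s) :
    mon x s ∈ Submodule.span ℤ {z | ∃ s' : Multiset (FlatVar M), s'.card = s.card ∧
      wt s < wt s' ∧ (∀ K : FlatVar M, K < G → (K ∈ s → K ∈ s') ∧
        cnt (K < ·) s' = cnt (K < ·) s) ∧ z = mon x s'} := by
  classical
  obtain ⟨t, hst⟩ : ∃ t, s = t + Multiset.replicate (cnt (· = G) s) G := by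
    refine ⟨s.filter (fun v => ¬ v = G), ?_⟩
    nth_rewrite 1 [← Multiset.filter_add_not (fun v => v = G) s]
    rw [add_comm, Multiset.filter_eq' s G]
    congr 2
    unfold cnt
    rw [Multiset.count]
    congr! 1
    exact eq_comm
  set n := cnt (· = G) s with hn'
  clear_value n
  subst hst
  have hF' : Base t F := by
    rcases hF with h | ⟨f, hf, rfl⟩
    · exact Or.inl h
    · refine Or.inr ⟨f, ?_, rfl⟩
      rcases Multiset.mem_add.1 hf with h | h
      · exact h
      · rw [Multiset.eq_of_mem_replicate h] at hFG
        exact absurd hFG (ssubset_irrefl _)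
  refine Submodule.span_mono ?_ (reduce_core hx hF' G hFG n hn)
  rintro _ ⟨p, u, hp, hpu, hu, rfl⟩
  refine ⟨_, ?_, ?_, ?_, rfl⟩
  · simp only [Multiset.card_add, Multiset.card_replicate]; omega
  · have h1 := wt_ge (n := G.1.card + 1) u (fun v hv => Finset.card_lt_card (hu v hv))
    simp only [wt_add, wt_rep]
    have : n * G.1.card = p * G.1.card + u.card * G.1.card := by rw [← hpu]; ring
    rw [mul_add, mul_one] at h1
    omega
  · intro K hK
    refine ⟨fun h => ?_, ?_⟩
    · rcases Multiset.mem_add.1 h with h | h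
      · simp [h]
      · rw [Multiset.eq_of_mem_replicate h] at hK
        exact absurd hK (lt_irrefl _)
    · simp only [cnt_add]
      rw [cnt_rep_pos _ _ hK, cnt_rep_pos _ _ hK, cnt_all _ (fun v hv => hK.trans (hu v hv))]
      omega

/-! ### Spanning by FY monomials -/

/-- FY monomials. -/
def FY (s : Multiset (FlatVar M)) : Prop :=
  Ch s ∧ ∀ F, Base s F → ∀ G ∈ s, F ⊂ G.1 → cnt (· = G) s + M.rk F < M.rk G.1

theorem span_FY (hx : Rel M x) : ∀ (N : ℕ) (s : Multiset (FlatVar M)),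
    s.card * Fintype.card E ≤ wt s + N →
    mon x s ∈ Submodule.span ℤ {z | ∃ s' : Multiset (FlatVar M), FY s' ∧ s'.card = s.card ∧
      z = mon x s'} := by
  intro N
  induction N using Nat.strong_induction_on with
  | _ N ih =>
    intro s hs
    by_cases hFY : FY s
    · exact Submodule.subset_span ⟨s, hFY, rfl, rfl⟩
    by_cases hch : Ch s
    · have : ∃ F, Base s F ∧ ∃ G ∈ s, F ⊂ G.1 ∧ M.rk G.1 ≤ M.rk F + cnt (· = G) s := by
        by_contra hcon
        apply hFY
        refine ⟨hch, fun F hF G hG hFG => ?_⟩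
        by_contra h2
        exact hcon ⟨F, hF, G, hG, hFG, by omega⟩
      obtain ⟨F, hF, G, hG, hFG, hn⟩ := this
      have h := reduce hx hF G hFG hn
      refine (Submodule.span_le.2 ?_) h
      rintro _ ⟨s', hc, hw, -, rfl⟩
      have hle := wt_le s'
      rw [hc] at hle
      have := ih (N - (wt s' - wt s)) (by omega) s' (by rw [hc]; omega)
      rw [hc] at this
      exact this
    · rw [mon_not_ch hx hch]
      exact Submodule.zero_mem _

/-! ### Chains -/

theorem Ch.mono {s t : Multiset (FlatVar M)} (h : Ch s) (hts : ∀ v ∈ t, v ∈ s) : Ch t :=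
  fun a ha b hb => h a (hts a ha) b (hts b hb)

theorem Ch.exists_max {s : Multiset (FlatVar M)} (h : Ch s) (hs : s ≠ 0) :
    ∃ m ∈ s, ∀ v ∈ s, v ≤ m := by
  induction s using Multiset.induction with
  | empty => exact absurd rfl hs
  | cons a s ih =>
    by_cases h0 : s = 0
    · subst h0
      exact ⟨a, by simp, by simp⟩
    · obtain ⟨m, hm, hmax⟩ := ih (h.mono fun v hv => Multiset.mem_cons_of_mem hv) h0
      rcases h a (Multiset.mem_cons_self _ _) m (Multiset.mem_cons_of_mem hm) with h1 | h1
      · refine ⟨m, Multiset.mem_cons_of_mem hm, fun v hv => ?_⟩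
        rcases Multiset.mem_cons.1 hv with rfl | hv
        · exact h1
        · exact hmax v hv
      · refine ⟨a, Multiset.mem_cons_self _ _, fun v hv => ?_⟩
        rcases Multiset.mem_cons.1 hv with rfl | hv
        · exact le_rfl
        · exact (hmax v hv).trans h1

theorem cnt_le_split {V : Type*} [PartialOrder V] (s : Multiset V) (G : V) :
    cnt (· ≤ G) s = cnt (· < G) s + cnt (· = G) s := by
  induction s using Multiset.induction with
  | empty => simp [cnt]
  | cons a s ih =>
    unfold cnt at *
    simp only [Multiset.countP_cons, ih]
    by_cases h1 : a = G
    · subst h1; simp; omega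
    · by_cases h2 : a < G
      · simp [h1, h2, h2.le]; omega
      · have : ¬ a ≤ G := fun h => h2 (lt_of_le_of_ne h h1)
        simp [h1, h2, this]

/-- Either nothing in `s` is below `G`, or there is a predecessor of `G`. -/
theorem Ch.pred {s : Multiset (FlatVar M)} (h : Ch s) (G : FlatVar M) :
    (∀ v ∈ s, ¬ v < G) ∨ ∃ P ∈ s, P < G ∧ ∀ v ∈ s, v < G ↔ v ≤ P := by
  classical
  by_cases h0 : s.filter (fun v => v < G) = 0
  · left
    rwa [Multiset.filter_eq_nil] at h0
  · right
    have h1 : Ch (s.filter (fun v => v < G)) := h.mono fun v hv => (Multiset.mem_filter.1 hv).1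
    obtain ⟨P, hP, hmax⟩ := h1.exists_max h0
    rw [Multiset.mem_filter] at hP
    exact ⟨P, hP.1, hP.2, fun v hv => ⟨fun hvG => hmax v (Multiset.mem_filter.2 ⟨hv, hvG⟩),
      fun hvP => lt_of_le_of_lt hvP hP.2⟩⟩

theorem chain_count {t : Multiset (FlatVar M)} (ht : Ch t) (K : FlatVar M)
    (hK : ∀ v ∈ t, K < v)
    (h : ∀ F G : FlatVar M, (F = K ∨ F ∈ t) → G ∈ t → F < G →
      cnt (· = G) t + M.rk F.1 < M.rk G.1) :
    ∀ (n : ℕ) (G : FlatVar M), G.1.card ≤ n → G ∈ t → cnt (· ≤ G) t + M.rk K.1 < M.rk G.1 := by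
  intro n
  induction n with
  | zero =>
    intro G hG
    exact absurd (Finset.card_eq_zero.1 (by omega)) G.2.2
  | succ n ih =>
    intro G hn hG
    rw [cnt_le_split]
    rcases ht.pred G with h0 | ⟨P, hP, hPG, hiff⟩
    · rw [cnt_none _ h0]
      have := h K G (Or.inl rfl) hG (hK G hG)
      omega
    · rw [cnt_congr hiff]
      have h1 := h P G (Or.inr hP) hG hPG
      have h2 := Finset.card_lt_card (show P.1 ⊂ G.1 from hPG)
      have h3 := ih P (by omega) hP
      omega

/-- The vanishing lemma. -/
theorem vanish (hx : Rel M x) (K : FlatVar M) (hKE : K.1 ≠ Finset.univ) :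
    ∀ (N : ℕ) (s : Multiset (FlatVar M)), s.card * Fintype.card E ≤ wt s + N →
    K ∈ s → M.rk Finset.univ ≤ M.rk K.1 + cnt (K < ·) s → mon x s = 0 := by
  classical
  have hrkK : M.rk K.1 < M.rk Finset.univ :=
    rk_lt M K.2.1 M.ground_mem ((Finset.subset_univ _).ssubset_of_ne hKE)
  intro N
  induction N using Nat.strong_induction_on with
  | _ N ih =>
    intro s hs hKs hcnt
    by_cases hch : Ch s
    swap
    · exact mon_not_ch hx hch
    by_cases hex : ∃ F G : FlatVar M, F ∈ s ∧ K ≤ F ∧ G ∈ s ∧ F < G ∧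
        M.rk G.1 ≤ M.rk F.1 + cnt (· = G) s
    · obtain ⟨F, G, hF, hKF, hG, hFG, hn⟩ := hex
      have h := reduce hx (Or.inr ⟨F, hF, rfl⟩ : Base s F.1) G hFG hn
      rw [← one_mul (mon x s)]
      refine mul_span_zero h ?_
      rintro _ ⟨s', hc, hw, hK', rfl⟩
      obtain ⟨hK1, hK2⟩ := hK' K (lt_of_le_of_lt hKF hFG)
      have hle := wt_le s'
      rw [hc] at hle
      rw [one_mul]
      exact ih (N - (wt s' - wt s)) (by omega) s' (by rw [hc]; omega) (hK1 hKs)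
        (by rw [hK2]; exact hcnt)
    · exfalso
      set t := s.filter (fun v => K < v) with htdef
      have hmem : ∀ v, v ∈ t ↔ v ∈ s ∧ K < v := fun v => Multiset.mem_filter
      have ht : Ch t := hch.mono fun v hv => ((hmem v).1 hv).1
      have hcard : cnt (K < ·) s = t.card := by
        rw [htdef, ← Multiset.countP_eq_card_filter]
        unfold cnt; congr!
      have hcount : ∀ G, K < G → cnt (· = G) t = cnt (· = G) s := by
        intro G hKG
        have h1 := congrArg (cnt (· = G)) (Multiset.filter_add_not (fun v => K < v) s)
        rw [cnt_add, ← htdef, cnt_none (s := s.filter fun v => ¬ K < v)] at h1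
        · omega
        · rintro v hv rfl
          exact (Multiset.mem_filter.1 hv).2 hKG
      have ht0 : t ≠ 0 := by
        intro h0
        rw [h0] at hcard
        simp at hcard
        omega
      obtain ⟨m, hm, hmax⟩ := ht.exists_max ht0
      have hc := chain_count ht K (fun v hv => ((hmem v).1 hv).2) (by
        intro F G hF hG hFG
        have hGs := (hmem G).1 hG
        rw [hcount G hGs.2]
        by_contra hcon
        apply hex
        rcases hF with rfl | hF
        · exact ⟨F, G, hKs, le_rfl, hGs.1, hFG, by omega⟩
        · have hFs := (hmem F).1 hF
          exact ⟨F, G, hFs.1, hFs.2.le, hGs.1, hFG, by omega⟩) _ m le_rfl hm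
      rw [cnt_all _ hmax] at hc
      have hmE : M.rk m.1 ≤ M.rk Finset.univ := by
        by_cases hm1 : m.1 = Finset.univ
        · rw [hm1]
        · exact (rk_lt M m.2.1 M.ground_mem
            ((Finset.subset_univ _).ssubset_of_ne hm1)).le
      omega

/-- The vanishing lemma, in terms of cumulative degrees. -/
theorem vanish' (hx : Rel M x) {r : ℕ} (hr : M.rk Finset.univ = r + 1)
    {s : Multiset (FlatVar M)} (hs : s.card = r) (K : FlatVar M) (hKE : K.1 ≠ Finset.univ)
    (hKs : K ∈ s) (h : cnt (· ≤ K) s < M.rk K.1) : mon x s = 0 := by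
  by_cases hch : Ch s
  swap
  · exact mon_not_ch hx hch
  refine vanish hx K hKE _ s (Nat.le_add_left _ _) hKs ?_
  have h1 := cnt_not (· ≤ K) s
  have h2 : cnt (fun v => ¬ v ≤ K) s = cnt (K < ·) s := by
    apply cnt_congr
    intro v hv
    constructor
    · intro hn
      rcases hch v hv K hKs with h3 | h3
      · exact absurd h3 hn
      · exact lt_of_le_of_ne h3 (fun he => hn he.ge)
    · exact fun h3 h4 => absurd h3 (not_lt_of_ge h4)
  omega

/-! ### Saturated monomials -/

variable {T : FlatVar M}

theorem le_top' (hT : T.1 = Finset.univ) (v : FlatVar M) : v ≤ T := by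
  show v.1 ⊆ T.1
  rw [hT]; exact Finset.subset_univ _

theorem ne_univ (hT : T.1 = Finset.univ) {v : FlatVar M} (h : v ≠ T) : v.1 ≠ Finset.univ :=
  fun h2 => h (Subtype.ext (h2.trans hT.symm))

theorem lt_top'' (hT : T.1 = Finset.univ) {v : FlatVar M} (h : v ≠ T) : v < T :=
  lt_of_le_of_ne (le_top' hT v) h

theorem up_pow_sub (F : FlatVar M) (hFT : F < T) (q : ℕ) : up x F ^ q - x T ^ q ∈
    Submodule.span ℤ {z | ∃ u : Multiset (FlatVar M), u.card = q ∧ (∀ v ∈ u, F < v) ∧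
      (∃ H ∈ u, H ≠ T) ∧ z = mon x u} := by
  classical
  induction q with
  | zero => simp
  | succ q ih =>
    rw [show up x F ^ (q + 1) - x T ^ (q + 1) =
      up x F * (up x F ^ q - x T ^ q) + (up x F - x T) * x T ^ q by ring]
    refine Submodule.add_mem _ (mul_span ih ?_) ?_
    · rintro _ ⟨u, hu, hG, ⟨H0, hH0, hne⟩, rfl⟩
      rw [up, Finset.sum_mul]
      refine Submodule.sum_mem _ fun H hH => ?_
      simp only [Finset.mem_filter, Finset.mem_univ, true_and] at hH
      refine Submodule.subset_span ⟨H ::ₘ u, by simp [hu], ?_,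
        ⟨H0, Multiset.mem_cons_of_mem hH0, hne⟩, (mon_cons H u).symm⟩
      intro v hv
      rcases Multiset.mem_cons.1 hv with rfl | hv
      · exact hH
      · exact hG v hv
    · have h1 : up x F - x T = ∑ H ∈ (Finset.univ.filter fun H : FlatVar M => F < H).erase T,
          x H := by
        rw [up, ← Finset.add_sum_erase (Finset.univ.filter fun H : FlatVar M => F < H) x
          (a := T) (by simpa using hFT)]
        ring
      rw [h1, Finset.sum_mul]
      refine Submodule.sum_mem _ fun H hH => ?_
      simp only [Finset.mem_erase, Finset.mem_filter, Finset.mem_univ, true_and] at hH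
      refine Submodule.subset_span ⟨H ::ₘ Multiset.replicate q T, by simp, ?_,
        ⟨H, Multiset.mem_cons_self _ _, hH.1⟩, by rw [mon_cons, mon_rep]⟩
      intro v hv
      rcases Multiset.mem_cons.1 hv with rfl | hv
      · exact hH.2
      · rw [Multiset.eq_of_mem_replicate hv]; exact hFT

/-- Saturated monomials: those of degree `r` whose cumulative degrees are the ranks. -/
def Sat (T : FlatVar M) (r : ℕ) (s : Multiset (FlatVar M)) : Prop :=
  Ch s ∧ s.card = r ∧ ∀ F ∈ s, F ≠ T → cnt (· ≤ F) s = M.rk F.1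

theorem sat_step (hx : Rel M x) (hT : T.1 = Finset.univ) {r : ℕ}
    (hr : M.rk Finset.univ = r + 1) (L : Multiset (FlatVar M)) (F : FlatVar M) (e f : ℕ)
    (hFT : F ≠ T) (he : 0 < e) (hc : L.card + e + f = r)
    (hLe : L.card + e = M.rk F.1) (K : Finset E) (hK : Base L K) (hKF : K ⊂ F.1)
    (hrk : M.rk F.1 ≤ M.rk K + e) :
    mon x (L + Multiset.replicate e F + Multiset.replicate f T) =
      - mon x (L + Multiset.replicate (e + f) T) := by
  have hFT' := lt_top'' hT hFT
  have hTF : ¬ T ≤ F := fun h => absurd hFT' (not_lt_of_ge h)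
  rw [mon_add, mon_add, mon_rep, mon_rep, mon_add, mon_rep, expand hx hK F hKF e hrk, neg_mul,
    Finset.sum_mul, neg_inj, Finset.sum_eq_single 0]
  · simp only [pow_zero, Nat.sub_zero, one_mul, Nat.choose_zero_right, Nat.cast_one, mul_one]
    rw [← sub_eq_zero, show mon x L * up x F ^ e * x T ^ f - mon x L * x T ^ (e + f) =
      (mon x L * x T ^ f) * (up x F ^ e - x T ^ e) by ring]
    refine mul_span_zero (up_pow_sub F hFT' e) ?_
    rintro _ ⟨u, hu, hFu, ⟨H, hH, hHT⟩, rfl⟩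
    rw [← mon_rep, ← mon_add, ← mon_add]
    refine vanish' hx hr ?_ H (ne_univ hT hHT) (by simp [hH]) ?_
    · simp only [Multiset.card_add, Multiset.card_replicate]; omega
    · have h1 := cnt_le (· ≤ H) L
      have h2 := cnt_le (· ≤ H) u
      have h3 := rk_lt M F.2.1 H.2.1 (hFu H hH)
      rw [cnt_add, cnt_add, cnt_rep_neg]
      · omega
      · exact fun h => absurd (lt_top'' hT hHT) (not_lt_of_ge h)
  · intro m hm hm0
    rw [Finset.mem_range] at hm
    rw [show mon x L * (x F ^ m * up x F ^ (e - m) * (e.choose m : A)) * x T ^ f =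
      (e.choose m : A) * ((mon x L * x F ^ m * x T ^ f) * up x F ^ (e - m)) by ring]
    rw [mul_span_zero (up_pow F (e - m)), mul_zero]
    rintro _ ⟨u, hu, hFu, rfl⟩
    rw [← mon_rep, ← mon_rep, ← mon_add, ← mon_add, ← mon_add]
    refine vanish' hx hr ?_ F (ne_univ hT hFT) ?_ ?_
    · simp only [Multiset.card_add, Multiset.card_replicate]; omega
    · simp only [Multiset.mem_add, Multiset.mem_replicate]
      exact Or.inl (Or.inl (Or.inr ⟨hm0, trivial⟩))
    · have h1 := cnt_le (· ≤ F) L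
      simp only [cnt_add]
      rw [cnt_rep_pos (· ≤ F) _ le_rfl, cnt_rep_neg (· ≤ F) _ hTF,
        cnt_none (s := u) _ (fun v hv h => absurd (hFu v hv) (not_lt_of_ge h))]
      omega
  · intro h
    exact absurd (Finset.mem_range.2 he) h

theorem sat_unit (hx : Rel M x) (hT : T.1 = Finset.univ) {r : ℕ}
    (hr : M.rk Finset.univ = r + 1) : ∀ (n : ℕ) (s : Multiset (FlatVar M)), Sat T r s →
    cnt (· ≠ T) s ≤ n → mon x s = x T ^ r ∨ mon x s = - x T ^ r := by
  classical
  intro n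
  induction n with
  | zero =>
    intro s hs hn
    left
    have h1 : ∀ v ∈ s, v = T := by
      have : cnt (· ≠ T) s = 0 := by omega
      simpa using of_cnt_zero _ this
    rw [Multiset.eq_replicate_of_mem h1, mon_rep, hs.2.1]
  | succ n ih =>
    intro s hs hn
    obtain ⟨hch, hcard, hsat⟩ := hs
    by_cases h0 : s.filter (fun v => v ≠ T) = 0
    · left
      have h1 : ∀ v ∈ s, v = T := by
        rw [Multiset.filter_eq_nil] at h0
        simpa using h0
      rw [Multiset.eq_replicate_of_mem h1, mon_rep, hcard]
    · obtain ⟨F, hF, hmax⟩ := (hch.mono (t := s.filter (fun v => v ≠ T))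
        fun v hv => (Multiset.mem_filter.1 hv).1).exists_max h0
      rw [Multiset.mem_filter] at hF
      obtain ⟨hFs, hFT⟩ := hF
      have hmax' : ∀ v ∈ s, v ≠ T → v ≤ F := fun v hv hvT =>
        hmax v (Multiset.mem_filter.2 ⟨hv, hvT⟩)
      obtain ⟨L, e, f, hL, he, hLs, rfl⟩ : ∃ (L : Multiset (FlatVar M)) (e f : ℕ),
          (∀ v ∈ L, v < F) ∧ 0 < e ∧ (∀ v ∈ L, v ∈ s) ∧
          s = L + Multiset.replicate e F + Multiset.replicate f T := by
        refine ⟨s.filter (fun v => v < F), s.count F,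
          ((s.filter fun v => ¬ v < F).filter fun v => ¬ v = F).card,
          fun v hv => (Multiset.mem_filter.1 hv).2, Multiset.count_pos.2 hFs,
          fun v hv => (Multiset.mem_filter.1 hv).1, ?_⟩
        nth_rewrite 1 [← Multiset.filter_add_not (fun v => v < F) s]
        nth_rewrite 1 [← Multiset.filter_add_not (fun v => v = F) (s.filter fun v => ¬ v < F)]
        rw [← add_assoc]
        congr 1
        · congr 1
          rw [Multiset.filter_eq', Multiset.count_filter, if_pos (lt_irrefl F)]
        · apply Multiset.eq_replicate_of_mem
          intro v hv
          simp only [Multiset.mem_filter] at hv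
          by_contra hvT
          exact hv.1.2 (lt_of_le_of_ne (hmax' v hv.1.1 hvT) hv.2)
      have hFT' := lt_top'' hT hFT
      have hLT : ∀ v ∈ L, v ≠ T := fun v hv => ((hL v hv).trans hFT').ne
      have hTF : ¬ T ≤ F := fun h => absurd hFT' (not_lt_of_ge h)
      have hcard' : L.card + e + f = r := by
        simpa only [Multiset.card_add, Multiset.card_replicate] using hcard
      have hLe : L.card + e = M.rk F.1 := by
        rw [← hsat F hFs hFT, cnt_add, cnt_add, cnt_rep_pos (· ≤ F) _ le_rfl,
          cnt_rep_neg (· ≤ F) _ hTF, cnt_all (s := L) _ (fun v hv => (hL v hv).le)]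
        omega
      have hcum : ∀ G, G < F → ∀ g, cnt (· ≤ G) (L + Multiset.replicate g T) =
          cnt (· ≤ G) (L + Multiset.replicate e F + Multiset.replicate f T) := by
        intro G hG g
        have h1 : ¬ F ≤ G := fun h => absurd hG (not_lt_of_ge h)
        have h2 : ¬ T ≤ G := fun h => absurd (hG.trans hFT') (not_lt_of_ge h)
        simp only [cnt_add]
        rw [cnt_rep_neg (· ≤ G) _ h1, cnt_rep_neg (· ≤ G) _ h2, cnt_rep_neg (· ≤ G) _ h2]
      obtain ⟨K, hK, hKF, hrk⟩ : ∃ K, Base L K ∧ K ⊂ F.1 ∧ M.rk F.1 ≤ M.rk K + e := by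
        by_cases hL0 : L = 0
        · refine ⟨∅, Or.inl rfl, ?_, ?_⟩
          · exact Finset.empty_ssubset.2 (Finset.nonempty_iff_ne_empty.2 F.2.2)
          · rw [hL0] at hLe
            simp at hLe
            omega
        · obtain ⟨K, hK, hKmax⟩ := (hch.mono hLs).exists_max hL0
          refine ⟨K.1, Or.inr ⟨K, hK, rfl⟩, hL K hK, ?_⟩
          have := hsat K (hLs K hK) (hLT K hK)
          rw [← hcum K (hL K hK) 0, cnt_add, cnt_all (s := L) _ hKmax] at this
          omega
      rw [sat_step hx hT hr L F e f hFT he hcard' hLe K hK hKF hrk]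
      have hnew : Sat T r (L + Multiset.replicate (e + f) T) := by
        refine ⟨?_, ?_, ?_⟩
        · intro a ha b hb
          by_cases haT : a = T
          · exact Or.inr (haT ▸ le_top' hT b)
          by_cases hbT : b = T
          · exact Or.inl (hbT ▸ le_top' hT a)
          have : ∀ v ∈ L + Multiset.replicate (e + f) T, v ≠ T → v ∈ L := by
            intro v hv hvT
            rcases Multiset.mem_add.1 hv with h | h
            · exact h
            · exact absurd (Multiset.eq_of_mem_replicate h) hvT
          exact hch a (hLs a (this a ha haT)) b (hLs b (this b hb hbT))
        · simp only [Multiset.card_add, Multiset.card_replicate]; omega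
        · intro G hG hGT
          have hGL : G ∈ L := by
            rcases Multiset.mem_add.1 hG with h | h
            · exact h
            · exact absurd (Multiset.eq_of_mem_replicate h) hGT
          rw [hcum G (hL G hGL), hsat G (hLs G hGL) hGT]
      have hdec : cnt (· ≠ T) (L + Multiset.replicate (e + f) T) ≤ n := by
        simp only [cnt_add] at hn ⊢
        rw [cnt_rep_pos (· ≠ T) _ hFT] at hn
        rw [cnt_rep_neg (· ≠ T) _ (by simp)]
        omega
      rcases ih _ hnew hdec with h | h
      · right; rw [h]
      · left; rw [h, neg_neg]

/-! ### Dual monomials -/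

theorem dual_aux {s : Multiset (FlatVar M)} (hs : FY s) : ∀ (n : ℕ) (F : FlatVar M),
    F.1.card ≤ n → F ∈ s → ∃ t : Multiset (FlatVar M), (∀ v ∈ t, v ∈ s ∧ v ≤ F) ∧
      ∀ G ∈ s, G ≤ F → G ∈ t ∧ cnt (· ≤ G) s + cnt (· ≤ G) t = M.rk G.1 := by
  intro n
  induction n with
  | zero =>
    intro F hF
    exact absurd (Finset.card_eq_zero.1 (by omega)) F.2.2
  | succ n ih =>
    intro F hn hF
    rcases hs.1.pred F with h0 | ⟨P, hP, hPF, hiff⟩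
    · have h1 := hs.2 ∅ (Or.inl rfl) F hF
        (Finset.empty_ssubset.2 (Finset.nonempty_iff_ne_empty.2 F.2.2))
      rw [M.rk_empty] at h1
      refine ⟨Multiset.replicate (M.rk F.1 - cnt (· = F) s) F, ?_, ?_⟩
      · intro v hv
        rw [Multiset.eq_of_mem_replicate hv]
        exact ⟨hF, le_rfl⟩
      · intro G hG hGF
        have hGF' : G = F := by
          by_contra hne
          exact h0 G hG (lt_of_le_of_ne hGF hne)
        subst hGF'
        refine ⟨Multiset.mem_replicate.2 ⟨by omega, rfl⟩, ?_⟩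
        rw [cnt_le_split, cnt_none (s := s) (· < G) h0, cnt_rep_pos (· ≤ G) _ le_rfl]
        omega
    · have h1 := hs.2 P.1 (Or.inr ⟨P, hP, rfl⟩) F hF hPF
      have h2 := Finset.card_lt_card (show P.1 ⊂ F.1 from hPF)
      obtain ⟨t, ht1, ht2⟩ := ih P (by omega) hP
      refine ⟨t + Multiset.replicate (M.rk F.1 - M.rk P.1 - cnt (· = F) s) F, ?_, ?_⟩
      · intro v hv
        rcases Multiset.mem_add.1 hv with hv | hv
        · exact ⟨(ht1 v hv).1, (ht1 v hv).2.trans hPF.le⟩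
        · rw [Multiset.eq_of_mem_replicate hv]
          exact ⟨hF, le_rfl⟩
      · intro G hG hGF
        rcases eq_or_lt_of_le hGF with hGF' | hGF'
        · subst hGF'
          refine ⟨Multiset.mem_add.2 (Or.inr (Multiset.mem_replicate.2 ⟨by omega, rfl⟩)), ?_⟩
          have h3 := (ht2 P hP le_rfl).2
          rw [cnt_all (s := t) (· ≤ P) (fun v hv => (ht1 v hv).2)] at h3
          rw [cnt_le_split, cnt_congr hiff, cnt_add, cnt_rep_pos (· ≤ G) _ le_rfl,
            cnt_all (s := t) (· ≤ G) (fun v hv => (ht1 v hv).2.trans hPF.le)]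
          omega
        · obtain ⟨h3, h4⟩ := ht2 G hG ((hiff G hG).1 hGF')
          refine ⟨Multiset.mem_add.2 (Or.inl h3), ?_⟩
          rw [cnt_add, cnt_rep_neg (· ≤ G) _ (fun h => absurd hGF' (not_lt_of_ge h))]
          omega

theorem exists_dual (hT : T.1 = Finset.univ) {r : ℕ} (hr : M.rk Finset.univ = r + 1)
    {s : Multiset (FlatVar M)} (hs : FY s) (hc : s.card ≤ r) :
    ∃ t : Multiset (FlatVar M), (∀ v ∈ s, v ≠ T → v ∈ t) ∧ Sat T r (s + t) := by
  rw [← hT] at hr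
  have hch : ∀ t : Multiset (FlatVar M), (∀ v ∈ t, v ≠ T → v ∈ s) → Ch (s + t) := by
    intro t ht a ha b hb
    by_cases haT : a = T
    · exact Or.inr (haT ▸ le_top' hT b)
    by_cases hbT : b = T
    · exact Or.inl (hbT ▸ le_top' hT a)
    have : ∀ v ∈ s + t, v ≠ T → v ∈ s := by
      intro v hv hvT
      rcases Multiset.mem_add.1 hv with h | h
      · exact h
      · exact ht v h hvT
    exact hs.1 a (this a ha haT) b (this b hb hbT)
  rcases hs.1.pred T with h0 | ⟨P, hP, hPT, hiff⟩
  · have h1 : ∀ v ∈ s, v = T := by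
      intro v hv
      by_contra hne
      exact h0 v hv (lt_top'' hT hne)
    refine ⟨Multiset.replicate (r - s.card) T, fun v hv hvT => absurd (h1 v hv) hvT, ?_, ?_, ?_⟩
    · exact hch _ fun v hv hvT => absurd (Multiset.eq_of_mem_replicate hv) hvT
    · simp only [Multiset.card_add, Multiset.card_replicate]; omega
    · intro F hF hFT
      rcases Multiset.mem_add.1 hF with h | h
      · exact absurd (h1 F h) hFT
      · exact absurd (Multiset.eq_of_mem_replicate h) hFT
  · obtain ⟨t, ht1, ht2⟩ := dual_aux hs _ P le_rfl hP
    have h3 := (ht2 P hP le_rfl).2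
    rw [cnt_all (s := t) (· ≤ P) (fun v hv => (ht1 v hv).2)] at h3
    have h4 : s.card = cnt (· ≤ P) s + cnt (· = T) s := by
      rw [← cnt_congr hiff, ← cnt_le_split, cnt_all (· ≤ T) (fun v _ => le_top' hT v)]
    have h5 : s.card + t.card ≤ r := by
      by_cases hTs : T ∈ s
      · have := hs.2 P.1 (Or.inr ⟨P, hP, rfl⟩) T hTs hPT
        omega
      · have h6 : cnt (· = T) s = 0 := cnt_none _ fun v hv hvT => hTs (hvT ▸ hv)
        have := rk_lt M P.2.1 T.2.1 hPT
        omega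
    have hlow : ∀ v ∈ s, v ≠ T → v ≤ P := fun v hv hvT => (hiff v hv).1 (lt_top'' hT hvT)
    have hmem : ∀ v ∈ t + Multiset.replicate (r - s.card - t.card) T, v ≠ T → v ∈ s := by
      intro v hv hvT
      rcases Multiset.mem_add.1 hv with h | h
      · exact (ht1 v h).1
      · exact absurd (Multiset.eq_of_mem_replicate h) hvT
    refine ⟨t + Multiset.replicate (r - s.card - t.card) T, ?_, hch _ hmem, ?_, ?_⟩
    · intro v hv hvT
      exact Multiset.mem_add.2 (Or.inl (ht2 v hv (hlow v hv hvT)).1)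
    · simp only [Multiset.card_add, Multiset.card_replicate]; omega
    · intro F hF hFT
      have hFs : F ∈ s := by
        rcases Multiset.mem_add.1 hF with h | h
        · exact h
        · exact hmem F h hFT
      have := (ht2 F hFs (hlow F hFs hFT)).2
      rw [cnt_add, cnt_add,
        cnt_rep_neg (· ≤ F) _ (fun h => absurd (lt_top'' hT hFT) (not_lt_of_ge h))]
      omega

/-! ### Triangularity -/

theorem dom : ∀ (n : ℕ) (s s' : Multiset (FlatVar M)), s.card = n → s'.card = n → Ch s → Ch s' →
    (∀ F ∈ s', cnt (· ≤ F) s' ≤ cnt (· ≤ F) s) → wt s < wt s' ∨ s = s' := by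
  classical
  intro n
  induction n with
  | zero =>
    intro s s' h1 h2 _ _ _
    right
    rw [Multiset.card_eq_zero.1 h1, Multiset.card_eq_zero.1 h2]
  | succ n ih =>
    intro s s' h1 h2 hch hch' h
    obtain ⟨G, hG, hGmax⟩ := hch.exists_max (by rintro rfl; simp at h1)
    obtain ⟨F, hF, hFmax⟩ := hch'.exists_max (by rintro rfl; simp at h2)
    have hGF : G ≤ F := by
      have h3 := h F hF
      rw [cnt_all (s := s') (· ≤ F) hFmax] at h3
      have h4 := cnt_not (· ≤ F) s
      have h5 := of_cnt_zero (s := s) (fun v => ¬ v ≤ F) (by omega) G hG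
      exact not_not.1 h5
    obtain ⟨a, rfl⟩ := Multiset.exists_cons_of_mem hG
    obtain ⟨a', rfl⟩ := Multiset.exists_cons_of_mem hF
    rw [Multiset.card_cons] at h1 h2
    have hi := ih a a' (by omega) (by omega)
      (hch.mono fun v hv => Multiset.mem_cons_of_mem hv)
      (hch'.mono fun v hv => Multiset.mem_cons_of_mem hv) (by
        intro F' hF'
        by_cases hGF' : G ≤ F'
        · have h6 : cnt (· ≤ F') a = a.card :=
            cnt_all _ fun v hv => (hGmax v (Multiset.mem_cons_of_mem hv)).trans hGF'
          have h7 := cnt_le (· ≤ F') a'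
          omega
        · have h8 := h F' (Multiset.mem_cons_of_mem hF')
          rw [← Multiset.singleton_add, ← Multiset.singleton_add, cnt_add, cnt_add] at h8
          have h9 : cnt (· ≤ F') ({G} : Multiset (FlatVar M)) = 0 :=
            cnt_none _ fun v hv => by rw [Multiset.mem_singleton.1 hv]; exact hGF'
          omega)
    have hwt : ∀ (v : FlatVar M) (b : Multiset (FlatVar M)), wt (v ::ₘ b) = v.1.card + wt b := by
      intro v b; simp [wt]
    rw [hwt, hwt]
    rcases eq_or_lt_of_le hGF with hGF' | hGF'
    · subst hGF'
      rcases hi with hi | hi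
      · left; omega
      · right; rw [hi]
    · have := Finset.card_lt_card (show G.1 ⊂ F.1 from hGF')
      rcases hi with hi | hi
      · left; omega
      · left; rw [hi]; omega

theorem pair_zero (hx : Rel M x) (hT : T.1 = Finset.univ) {r : ℕ}
    (hr : M.rk Finset.univ = r + 1) {s s' t' : Multiset (FlatVar M)} (hs' : FY s')
    (ht : ∀ v ∈ s', v ≠ T → v ∈ t') (hsat : Sat T r (s' + t')) (hc : s.card = s'.card)
    (hno : ¬ (wt s < wt s' ∨ s = s')) : mon x (s + t') = 0 := by
  by_cases hch : Ch (s + t')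
  swap
  · exact mon_not_ch hx hch
  by_contra hne
  apply hno
  refine dom _ s s' hc rfl (hch.mono fun v hv => Multiset.mem_add.2 (Or.inl hv)) hs'.1 ?_
  intro F hF
  by_cases hFT : F = T
  · subst hFT
    rw [cnt_all (s := s) (· ≤ F) (fun v _ => le_top' hT v), hc]
    exact cnt_le _ _
  · by_contra hlt
    apply hne
    refine vanish' hx hr ?_ F (ne_univ hT hFT) (Multiset.mem_add.2 (Or.inr (ht F hF hFT))) ?_
    · have := hsat.2.1
      rw [Multiset.card_add] at this ⊢
      omega
    · have := hsat.2.2 F (Multiset.mem_add.2 (Or.inl hF)) hFT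
      rw [cnt_add] at this ⊢
      omega

/-! ### Linear algebra -/

theorem solve {ι : Type*} [Fintype ι] (P : Matrix ι ι ℤ) (w : ι → ℕ)
    (hz : ∀ i j, ¬ (w i < w j ∨ i = j) → P i j = 0) (hd : ∀ i, IsUnit (P i i)) :
    (∀ v : ι → ℤ, ∃ c : ι → ℤ, ∀ i, ∑ j, P i j * c j = v i) ∧
    (∀ c : ι → ℤ, (∀ j, ∑ i, c i * P i j = 0) → c = 0) := by
  classical
  have hdet : IsUnit P.det := by
    let b : ι → ℕ ×ₗ Fin (Fintype.card ι) := fun i => toLex (w i, Fintype.equivFin ι i)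
    have hb : Function.Injective b := by
      intro i j hij
      have := congrArg (fun z => (ofLex z).2) hij
      exact (Fintype.equivFin ι).injective this
    let _ : LinearOrder ι := LinearOrder.lift' b hb
    have htri : P.BlockTriangular id := by
      intro i j hji
      apply hz
      have hlt : b j < b i := hji
      rintro (h | h)
      · rw [Prod.Lex.lt_iff] at hlt
        rcases hlt with h1 | h1
        · exact absurd h1 (not_lt_of_gt h)
        · exact absurd h1.1 (ne_of_gt h)
      · subst h
        exact absurd hlt (lt_irrefl _)
    have h2 := Matrix.det_of_isUpperTriangular htri
    have h3 : IsUnit (∏ i, P i i) := by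
      rw [IsUnit.prod_univ_iff]
      exact hd
    rw [← h2] at h3
    convert h3
  constructor
  · intro v
    refine ⟨P⁻¹.mulVec v, fun i => ?_⟩
    have : P.mulVec (P⁻¹.mulVec v) = v := by
      rw [Matrix.mulVec_mulVec, Matrix.mul_nonsing_inv _ hdet, Matrix.one_mulVec]
    exact congrFun this i
  · intro c hc
    have h1 : Matrix.vecMul c P = 0 := funext hc
    have h2 : Matrix.vecMul (Matrix.vecMul c P) P⁻¹ = c := by
      rw [Matrix.vecMul_vecMul, Matrix.mul_nonsing_inv _ hdet, Matrix.vecMul_one]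
    rw [← h2, h1, Matrix.zero_vecMul]

/-! ### The Chow ring -/

/-- The generators of the Chow ring. -/
noncomputable def gen (M : SimpleFlatMatroid E) (v : FlatVar M) : ChowRing M :=
  chowMk M (MvPolynomial.X v)

theorem gen_rel (M : SimpleFlatMatroid E) : Rel M (gen M) where
  inc F G h1 h2 := by
    rw [gen, gen, ← map_mul]
    exact Ideal.Quotient.eq_zero_iff_mem.2
      (Ideal.subset_span (Or.inl ⟨F, G, h1, h2, rfl⟩))
  lin a := by
    unfold gen
    rw [← map_sum, Finset.sum_filter]
    exact Ideal.Quotient.eq_zero_iff_mem.2 (Ideal.subset_span (Or.inr ⟨a, rfl⟩))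

theorem mon_gen_eq (M : SimpleFlatMatroid E) (s : Multiset (FlatVar M)) :
    mon (gen M) s = chowMk M (s.map MvPolynomial.X).prod := by
  unfold mon gen
  rw [map_multiset_prod, Multiset.map_map]
  rfl

theorem mon_mem (M : SimpleFlatMatroid E) (s : Multiset (FlatVar M)) {k : ℕ} (hk : s.card = k) :
    mon (gen M) s ∈ chowComp M k := by
  rw [mon_gen_eq]
  refine Submodule.mem_map_of_mem (f := (chowMk M).toLinearMap) ?_
  rw [MvPolynomial.mem_homogeneousSubmodule]
  subst hk
  induction s using Multiset.induction with
  | empty => simpa using MvPolynomial.isHomogeneous_one _ _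
  | cons a s ih =>
    rw [Multiset.map_cons, Multiset.prod_cons, Multiset.card_cons, add_comm]
    exact (MvPolynomial.isHomogeneous_X ℤ a).mul ih

theorem comp_le (M : SimpleFlatMatroid E) (k : ℕ) : chowComp M k ≤
    Submodule.span ℤ {z | ∃ s : Multiset (FlatVar M), FY s ∧ s.card = k ∧
      z = mon (gen M) s} := by
  rintro _ ⟨p, hp, rfl⟩
  rw [SetLike.mem_coe, MvPolynomial.mem_homogeneousSubmodule] at hp
  rw [MvPolynomial.as_sum p, map_sum]
  refine Submodule.sum_mem _ fun u hu => ?_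
  have hdeg : (Finsupp.toMultiset u).card = k := by
    have := hp (MvPolynomial.mem_support_iff.1 hu)
    rw [← this, Finsupp.card_toMultiset, Finsupp.weight_apply]
    simp [Finsupp.sum]
  have h1 : MvPolynomial.monomial u (MvPolynomial.coeff u p) =
      MvPolynomial.coeff u p • ((Finsupp.toMultiset u).map MvPolynomial.X).prod := by
    rw [MvPolynomial.monomial_eq, MvPolynomial.smul_eq_C_mul, Finsupp.toMultiset_map,
      Finsupp.prod_toMultiset, Finsupp.prod_mapDomain_index (by simp) (by intros; rw [pow_add])]
  rw [h1, map_smul]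
  refine Submodule.smul_mem _ _ ?_
  have h2 := span_FY (gen_rel M) _ (Finsupp.toMultiset u) (Nat.le_add_left _ _)
  rw [hdeg, mon_gen_eq] at h2
  exact h2

theorem comp_mul (M : SimpleFlatMatroid E) {k l r : ℕ} (h : k + l = r) {a b : ChowRing M}
    (ha : a ∈ chowComp M k) (hb : b ∈ chowComp M l) : a * b ∈ chowComp M r := by
  obtain ⟨p, hp, rfl⟩ := ha
  obtain ⟨q, hq, rfl⟩ := hb
  rw [SetLike.mem_coe, MvPolynomial.mem_homogeneousSubmodule] at hp hq
  refine ⟨p * q, ?_, map_mul (chowMk M) p q⟩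
  rw [SetLike.mem_coe, MvPolynomial.mem_homogeneousSubmodule, ← h]
  exact hp.mul hq

/-- The pairing induced by a functional on the top degree part. -/
noncomputable def pairing (M : SimpleFlatMatroid E) {k l r : ℕ} (h : k + l = r)
    (d : chowComp M r →ₗ[ℤ] ℤ) : chowComp M k →ₗ[ℤ] chowComp M l →ₗ[ℤ] ℤ :=
  LinearMap.mk₂ ℤ (fun a b => d ⟨a.1 * b.1, comp_mul M h a.2 b.2⟩)
    (fun a a' b => by
      rw [← map_add]; congr 1; exact Subtype.ext (add_mul a.1 a'.1 b.1))
    (fun c a b => by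
      rw [← map_smul]; congr 1; exact Subtype.ext (smul_mul_assoc c a.1 b.1))
    (fun a b b' => by
      rw [← map_add]; congr 1; exact Subtype.ext (mul_add a.1 b.1 b'.1))
    (fun c a b => by
      rw [← map_smul]; congr 1; exact Subtype.ext (mul_smul_comm c a.1 b.1))

theorem pairing_apply (M : SimpleFlatMatroid E) {k l r : ℕ} (h : k + l = r)
    (d : chowComp M r →ₗ[ℤ] ℤ) (a : chowComp M k) (b : chowComp M l) :
    pairing M h d a b = d ⟨a.1 * b.1, comp_mul M h a.2 b.2⟩ := rfl

theorem core (hT : T.1 = Finset.univ) {k l r : ℕ} (hr : M.rk Finset.univ = r + 1)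
    (h : k + l = r) (d : chowComp M r →ₗ[ℤ] ℤ)
    (hd : ∀ z : chowComp M r, z.1 = gen M T ^ r → d z = 1) :
    (∀ φ : chowComp M k →ₗ[ℤ] ℤ, ∃ b : chowComp M l, ∀ a, pairing M h d a b = φ a) ∧
    (∀ a : chowComp M k, (∀ b : chowComp M l, pairing M h d a b = 0) → a = 0) := by
  classical
  have hx := gen_rel M
  let ι := {s : Sym (FlatVar M) k // FY (s : Multiset (FlatVar M))}
  have hfin : Fintype ι := inferInstance
  have hcard : ∀ i : ι, (i.1 : Multiset (FlatVar M)).card = k := fun i => i.1.2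
  choose t ht hsat using fun i : ι => exists_dual hT hr i.2 (by rw [hcard i]; omega)
  have hct : ∀ i, (t i).card = l := by
    intro i
    have := (hsat i).2.1
    rw [Multiset.card_add, hcard i] at this
    omega
  let b : ι → chowComp M k := fun i => ⟨mon (gen M) i.1, mon_mem M _ (hcard i)⟩
  let b' : ι → chowComp M l := fun i => ⟨mon (gen M) (t i), mon_mem M _ (hct i)⟩
  have hspan : ∀ a : chowComp M k, ∃ c : ι → ℤ, ∑ i, c i • b i = a := by
    intro a
    have h1 : a.1 ∈ Submodule.span ℤ (Set.range fun i => (b i).1) := by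
      refine Submodule.span_mono ?_ (comp_le M k a.2)
      rintro _ ⟨s, hs, hc, rfl⟩
      exact ⟨⟨⟨s, hc⟩, hs⟩, rfl⟩
    obtain ⟨c, hc⟩ := (Submodule.mem_span_range_iff_exists_fun ℤ).1 h1
    refine ⟨c, Subtype.ext ?_⟩
    rw [← hc]
    simp
  have hP := solve (Matrix.of fun i j : ι => pairing M h d (b i) (b' j))
    (fun i => wt (i.1 : Multiset (FlatVar M)))
    (by
      intro i j hno
      rw [Matrix.of_apply, pairing_apply]
      have h1 : mon (gen M) (i.1 + t j) = 0 := by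
        refine pair_zero hx hT hr j.2 (ht j) (hsat j) ((hcard i).trans (hcard j).symm) ?_
        rintro (h2 | h2)
        · exact hno (Or.inl h2)
        · exact hno (Or.inr (Subtype.ext (Subtype.ext h2)))
      rw [mon_add] at h1
      rw [← map_zero d]
      congr 1
      exact Subtype.ext h1)
    (by
      intro i
      rw [Matrix.of_apply, pairing_apply]
      have h1 := sat_unit hx hT hr _ _ (hsat i) le_rfl
      rw [mon_add] at h1
      rcases h1 with h1 | h1
      · rw [hd _ h1]; exact isUnit_one
      · have h2 := hd (-⟨(b i).1 * (b' i).1, comp_mul M h (b i).2 (b' i).2⟩) (by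
          show -(mon (gen M) i.1 * mon (gen M) (t i)) = _
          rw [h1, neg_neg])
        rw [map_neg] at h2
        rw [← IsUnit.neg_iff, h2]
        exact isUnit_one)
  obtain ⟨hP1, hP2⟩ := hP
  constructor
  · intro φ
    obtain ⟨c, hc⟩ := hP1 fun i => φ (b i)
    refine ⟨∑ j, c j • b' j, fun a => ?_⟩
    obtain ⟨e, rfl⟩ := hspan a
    rw [map_sum (pairing M h d), map_sum φ, LinearMap.sum_apply]
    refine Finset.sum_congr rfl fun i _ => ?_
    rw [map_smul (pairing M h d), map_smul φ, LinearMap.smul_apply, ← hc i, map_sum]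
    congr 1
    refine Finset.sum_congr rfl fun j _ => ?_
    rw [map_smul, smul_eq_mul, mul_comm, Matrix.of_apply]
  · intro a ha
    obtain ⟨e, rfl⟩ := hspan a
    have : e = 0 := by
      apply hP2
      intro j
      have := ha (b' j)
      rw [map_sum, LinearMap.sum_apply] at this
      rw [← this]
      refine Finset.sum_congr rfl fun i _ => ?_
      rw [map_smul, LinearMap.smul_apply, smul_eq_mul, Matrix.of_apply]
    simp [this]

end ChowPD

open SimpleFlatMatroid in
/-- **Poincaré duality for Chow rings of matroids.** For every finite simple matroid `M` of
rank `r+1` and every `0 ≤ k ≤ r`, the bilinear pairing `A^k × A^{r-k} → ℤ`,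
`(a, b) ↦ deg (a·b)`, is perfect: the map `A^{r-k} → Hom_ℤ(A^k, ℤ)` sending `b` to the
functional `a ↦ deg (a·b)` is a `ℤ`-module isomorphism.  Here `deg : A^r → ℤ` is the
linear map determined by `deg (x_E^r) = 1`. -/
theorem chow_poincare_duality {E : Type*} [Fintype E] [DecidableEq E] [Nonempty E]
    (M : SimpleFlatMatroid E) (r k : ℕ) (hr : M.rk Finset.univ = r + 1)
    (hk : k ≤ r) :
    ∀ d : chowComp M r →ₗ[ℤ] ℤ,
      (∀ z : chowComp M r, (z : ChowRing M) = chowMk M (xE M ^ r) → d z = 1) →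
      ∃ Φ : chowComp M (r - k) →ₗ[ℤ] (chowComp M k →ₗ[ℤ] ℤ),
        Function.Bijective Φ ∧
        ∀ (b : chowComp M (r - k)) (a : chowComp M k) (z : chowComp M r),
          (z : ChowRing M) = (a : ChowRing M) * (b : ChowRing M) → Φ b a = d z := by
  intro d hd
  have hT : (⟨Finset.univ, M.ground_mem, Finset.univ_nonempty.ne_empty⟩ : FlatVar M).1 =
    Finset.univ := rfl
  have hd' : ∀ z : chowComp M r, z.1 = ChowPD.gen M
      ⟨Finset.univ, M.ground_mem, Finset.univ_nonempty.ne_empty⟩ ^ r → d z = 1 := by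
    intro z hz
    apply hd
    rw [hz, map_pow]
    rfl
  have h1 : r - k + k = r := by omega
  have h2 : k + (r - k) = r := by omega
  have hcomm : ∀ a b, ChowPD.pairing M h1 d b a = ChowPD.pairing M h2 d a b := by
    intro a b
    rw [ChowPD.pairing_apply, ChowPD.pairing_apply]
    congr 1
    exact Subtype.ext (mul_comm _ _)
  refine ⟨ChowPD.pairing M h1 d, ⟨?_, ?_⟩, ?_⟩
  · rw [injective_iff_map_eq_zero]
    intro b hb
    apply (ChowPD.core hT hr h1 d hd').2
    intro a
    rw [hb, LinearMap.zero_apply]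
  · intro φ
    obtain ⟨b, hb⟩ := (ChowPD.core hT hr h2 d hd').1 φ
    refine ⟨b, LinearMap.ext fun a => ?_⟩
    rw [hcomm, hb]
  · intro b a z hz
    rw [hcomm, ChowPD.pairing_apply]
    congr 1
    exact Subtype.ext hz.symm
end

section
/- For every finite simple matroid M and all integers j, k ≥ 0, there exists a G-equivariant injection FY^{j+k} → FY^j × FY^k, where G is the automorphism group of M acting diagonally on the product; explicitly, the map factors each FY-monomial of degree j+k as a product b·c with b ∈ FY^j and c ∈ FY^k. -/
open Finset

namespace SimpleFlatMatroid

variable {E : Type*} [Fintype E] [DecidableEq E]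

theorem aux_rk_mono (M : SimpleFlatMatroid E) : ∀ n : ℕ, ∀ F ∈ M.flats, ∀ F' ∈ M.flats,
    F ⊆ F' → F'.card ≤ F.card + n → M.rk F ≤ M.rk F' := by
  intro n
  induction n with
  | zero =>
    intro F _ F' _ h hc
    rw [Finset.eq_of_subset_of_card_le h hc]
  | succ n ih =>
    intro F hF F' hF' h hc
    rcases eq_or_ne F F' with rfl | hne
    · exact le_rfl
    have hss : F ⊂ F' := h.ssubset_of_ne hne
    by_cases hex : ∃ F'' ∈ M.flats, F ⊂ F'' ∧ F'' ⊂ F'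
    · obtain ⟨F'', hF'', h1, h2⟩ := hex
      have c1 := Finset.card_lt_card h1
      have c2 := Finset.card_lt_card h2
      exact (ih F hF F'' hF'' h1.subset (by omega)).trans
        (ih F'' hF'' F' hF' h2.subset (by omega))
    · rw [M.rk_cover F hF F' hF' hss hex]
      omega

theorem aux_prev_mem (M : SimpleFlatMatroid E) (m : Finset E → ℕ)
    (h1 : ∀ F : Finset E, m F ≠ 0 → F ∈ M.flats ∧ F ≠ ∅)
    (h2 : ∀ F F' : Finset E, m F ≠ 0 → m F' ≠ 0 → F ⊆ F' ∨ F' ⊆ F) (F : Finset E) :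
    prevFlat m F ∈ M.flats := by
  have key : prevFlat m F = ∅ ∨ m (prevFlat m F) ≠ 0 := by
    unfold prevFlat
    refine Finset.sup_induction (p := fun A : Finset E => A = ∅ ∨ m A ≠ 0) (Or.inl rfl) ?_ ?_
    · rintro A (rfl | hA) B (rfl | hB)
      · left; simp
      · right; simpa using hB
      · right; simpa using hA
      · right
        rcases h2 A B hA hB with h | h
        · rw [sup_eq_right.2 h]; exact hB
        · rw [sup_eq_left.2 h]; exact hA
    · intro B _
      split_ifs with h
      · exact Or.inr h.1
      · exact Or.inl rfl
  rcases key with h | h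
  · rw [h]; exact M.empty_mem
  · exact (h1 _ h).1

theorem aux_isFY_of_le (M : SimpleFlatMatroid E) (m b : Finset E → ℕ) (hm : M.IsFY m)
    (hb : ∀ F, b F ≤ m F) : M.IsFY b := by
  obtain ⟨h1, h2, h3⟩ := hm
  have hne : ∀ F, b F ≠ 0 → m F ≠ 0 := fun F h => by have := hb F; omega
  have k1 : ∀ F : Finset E, b F ≠ 0 → F ∈ M.flats ∧ F ≠ ∅ := fun F h => h1 F (hne F h)
  have k2 : ∀ F F' : Finset E, b F ≠ 0 → b F' ≠ 0 → F ⊆ F' ∨ F' ⊆ F :=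
    fun F F' h h' => h2 F F' (hne F h) (hne F' h')
  refine ⟨k1, k2, fun F h => ?_⟩
  have hsub : prevFlat b F ⊆ prevFlat m F := by
    unfold prevFlat
    refine Finset.sup_mono_fun fun A _ => ?_
    by_cases hA : b A ≠ 0 ∧ A ⊂ F
    · rw [if_pos hA, if_pos ⟨hne A hA.1, hA.2⟩]
    · rw [if_neg hA]; exact Finset.empty_subset _
  have hr := aux_rk_mono M (prevFlat m F).card _ (aux_prev_mem M b k1 k2 F) _
    (aux_prev_mem M m h1 h2 F) hsub (by omega)
  have := h3 F (hne F h)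
  have := hb F
  omega

/-- the total degree of the part of `m` on sets of size `< n` -/
def auxLow (m : Finset E → ℕ) (n : ℕ) : ℕ :=
  ∑ F ∈ (Finset.univ : Finset (Finset E)).filter (fun F => F.card < n), m F

/-- greedily take the lowest `j` factors of `m` -/
def auxTake (j : ℕ) (m : Finset E → ℕ) : Finset E → ℕ :=
  fun F => min (m F) (j - auxLow m F.card)

theorem auxLow_succ (m : Finset E → ℕ) (n : ℕ) : auxLow m (n + 1) = auxLow m n +
    ∑ F ∈ (Finset.univ : Finset (Finset E)).filter (fun F => F.card = n), m F := by
  unfold auxLow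
  rw [← Finset.sum_union]
  · congr 1
    ext F
    simp only [Finset.mem_filter, Finset.mem_univ, true_and, Finset.mem_union]
    omega
  · rw [Finset.disjoint_left]
    intro F
    simp only [Finset.mem_filter, Finset.mem_univ, true_and]
    omega

theorem auxLow_top (m : Finset E → ℕ) : auxLow m (Fintype.card E + 1) = deg m := by
  unfold auxLow deg
  rw [Finset.filter_true_of_mem]
  intro F _
  have := Finset.card_le_univ F
  omega

theorem auxLow_take (j : ℕ) (m : Finset E → ℕ)
    (h2 : ∀ F F' : Finset E, m F ≠ 0 → m F' ≠ 0 → F ⊆ F' ∨ F' ⊆ F) (n : ℕ) :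
    auxLow (auxTake j m) n = min (auxLow m n) j := by
  induction n with
  | zero => simp [auxLow]
  | succ n ih =>
    rw [auxLow_succ, auxLow_succ, ih]
    have key : ∑ F ∈ (Finset.univ : Finset (Finset E)).filter (fun F => F.card = n),
        auxTake j m F = min (∑ F ∈ (Finset.univ : Finset (Finset E)).filter
          (fun F => F.card = n), m F) (j - auxLow m n) := by
      by_cases hex : ∃ A : Finset E, A.card = n ∧ m A ≠ 0
      · obtain ⟨A, hA, hmA⟩ := hex
        have hz : ∀ B ∈ (Finset.univ : Finset (Finset E)).filter (fun F => F.card = n),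
            B ≠ A → m B = 0 := by
          intro B hB hBA
          by_contra hmB
          have hB : B.card = n := by simpa using hB
          rcases h2 A B hmA hmB with h | h
          · exact hBA (Finset.eq_of_subset_of_card_le h (by omega)).symm
          · exact hBA (Finset.eq_of_subset_of_card_le h (by omega))
        have hAm : A ∈ (Finset.univ : Finset (Finset E)).filter (fun F => F.card = n) := by
          simpa using hA
        rw [Finset.sum_eq_single_of_mem A hAm hz, Finset.sum_eq_single_of_mem A hAm]
        · simp [auxTake, hA]
        · intro B hB hBA
          simp [auxTake, hz B hB hBA]
      · push Not at hex
        rw [Finset.sum_eq_zero, Finset.sum_eq_zero]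
        · simp
        · intro F hF
          exact hex F (by simpa using hF)
        · intro F hF
          simp [auxTake, hex F (by simpa using hF)]
    rw [key]
    omega

theorem auxLow_mact (g : Equiv.Perm E) (m : Finset E → ℕ) (n : ℕ) :
    auxLow (mact g m) n = auxLow m n := by
  unfold auxLow mact
  refine Finset.sum_bij' (fun F _ => F.image (g⁻¹ : Equiv.Perm E)) (fun F _ => F.image g)
    ?_ ?_ ?_ ?_ ?_
  · intro F hF
    simpa [Finset.card_image_of_injective _ g.symm.injective] using hF
  · intro F hF
    simpa [Finset.card_image_of_injective _ g.injective] using hF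
  · intro F _
    ext x
    simp
  · intro F _
    ext x
    simp
  · intro F _
    rfl

theorem auxTake_mact (j : ℕ) (g : Equiv.Perm E) (m : Finset E → ℕ) :
    auxTake j (mact g m) = mact g (auxTake j m) := by
  funext F
  simp only [auxTake, auxLow_mact]
  simp only [mact, auxTake, Finset.card_image_of_injective _ (g⁻¹).injective]

theorem deg_auxTake (j k : ℕ) (m : Finset E → ℕ)
    (h2 : ∀ F F' : Finset E, m F ≠ 0 → m F' ≠ 0 → F ⊆ F' ∨ F' ⊆ F) (hd : deg m = j + k) :
    deg (auxTake j m) = j := by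
  rw [← auxLow_top, auxLow_take j m h2, auxLow_top, hd]
  omega

theorem auxTake_le (j : ℕ) (m : Finset E → ℕ) (F : Finset E) : auxTake j m F ≤ m F :=
  min_le_left _ _

theorem deg_auxRest (j k : ℕ) (m : Finset E → ℕ)
    (h2 : ∀ F F' : Finset E, m F ≠ 0 → m F' ≠ 0 → F ⊆ F' ∨ F' ⊆ F) (hd : deg m = j + k) :
    deg (fun F => m F - auxTake j m F) = k := by
  have h := deg_auxTake j k m h2 hd
  have : deg m = deg (auxTake j m) + deg (fun F => m F - auxTake j m F) := by
    unfold deg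
    rw [← Finset.sum_add_distrib]
    refine Finset.sum_congr rfl fun F _ => ?_
    have := auxTake_le j m F
    omega
  omega

end SimpleFlatMatroid

open SimpleFlatMatroid in
/-- For every finite simple matroid `M` and all `j, k ≥ 0`, there is a `G`-equivariant
injection `FY^{j+k} → FY^j × FY^k` (with `G = Aut(M)` acting diagonally on the product),
which moreover factors each FY-monomial `a` of degree `j+k` as a product `a = b·c` with
`b ∈ FY^j` and `c ∈ FY^k` (products of monomials correspond to sums of exponent vectors). -/
theorem fy_equivariant_injection_into_product {E : Type*} [Fintype E] [DecidableEq E]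
    (M : SimpleFlatMatroid E) (j k : ℕ) :
    ∃ φ : M.FYk (j + k) → M.FYk j × M.FYk k,
      Function.Injective φ ∧
      (∀ a : M.FYk (j + k),
        (a : Finset E → ℕ)
          = fun F => ((φ a).1 : Finset E → ℕ) F + ((φ a).2 : Finset E → ℕ) F) ∧
      (∀ g : Equiv.Perm E, M.IsAut g → ∀ a b : M.FYk (j + k),
        (b : Finset E → ℕ) = mact g (a : Finset E → ℕ) →
        ((φ b).1 : Finset E → ℕ) = mact g ((φ a).1 : Finset E → ℕ) ∧
        ((φ b).2 : Finset E → ℕ) = mact g ((φ a).2 : Finset E → ℕ)) := by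
  have hsum : ∀ (m : Finset E → ℕ) (F : Finset E),
      m F = auxTake j m F + (m F - auxTake j m F) := by
    intro m F
    have := auxTake_le j m F
    omega
  refine ⟨fun a =>
    (⟨auxTake j a.1, aux_isFY_of_le M a.1 _ a.2.1 (auxTake_le j a.1),
        deg_auxTake j k a.1 a.2.1.2.1 a.2.2⟩,
      ⟨fun F => a.1 F - auxTake j a.1 F,
        aux_isFY_of_le M a.1 _ a.2.1 (fun F => Nat.sub_le _ _),
        deg_auxRest j k a.1 a.2.1.2.1 a.2.2⟩), ?_, ?_, ?_⟩
  · intro a b hab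
    apply Subtype.ext
    funext F
    have e1 := congrFun (congrArg (fun p => (p.1 : Finset E → ℕ)) hab) F
    have e2 := congrFun (congrArg (fun p => (p.2 : Finset E → ℕ)) hab) F
    simp only at e1 e2
    rw [hsum a.1 F, hsum b.1 F, e2, e1]
  · intro a
    funext F
    exact hsum a.1 F
  · intro g _ a b hb
    simp only [hb, auxTake_mact]
    exact ⟨trivial, rfl⟩
end

section
/- Let M be a finite simple matroid of rank r+1 ≤ 6 with automorphism group G. Then for all integers 0 ≤ i ≤ j ≤ k ≤ ℓ ≤ r with i + ℓ = j + k, there exists a G-equivariant injection FY^i × FY^ℓ → FY^j × FY^k, where G acts diagonally on each product. (Equivalently, the sequence of G-sets (FY^0, …, FY^r) is Burnside PF₂, i.e., all 2×2 minors of the associated Toeplitz matrix are nonnegative in the Burnside ring B(G).) -/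
open Finset

namespace SimpleFlatMatroid

section Helpers

set_option linter.unusedSectionVars false
set_option linter.unusedSimpArgs false

variable {E : Type*} [Fintype E] [DecidableEq E]

lemma mem_prevFlat (m : Finset E → ℕ) (F : Finset E) (x : E) :
    x ∈ prevFlat m F ↔ ∃ F', m F' ≠ 0 ∧ F' ⊂ F ∧ x ∈ F' := by
  unfold prevFlat
  rw [Finset.mem_sup]
  constructor
  · rintro ⟨F', -, h⟩
    split_ifs at h with h1
    · exact ⟨F', h1.1, h1.2, h⟩
    · simp at h
  · rintro ⟨F', h1, h2, h3⟩
    exact ⟨F', Finset.mem_univ _, by simp [h1, h2, h3]⟩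

/-- the union of all members of the support -/
def topFlat (m : Finset E → ℕ) : Finset E :=
  (Finset.univ.filter fun F => m F ≠ 0).sup id

lemma mem_topFlat (m : Finset E → ℕ) (x : E) :
    x ∈ topFlat m ↔ ∃ F', m F' ≠ 0 ∧ x ∈ F' := by
  unfold topFlat
  rw [Finset.mem_sup]
  simp

lemma image_inv_image (g : Equiv.Perm E) (F : Finset E) :
    (F.image g).image (g⁻¹ : Equiv.Perm E) = F := by
  ext x; simp [Finset.mem_image]

lemma image_image_inv (g : Equiv.Perm E) (F : Finset E) :
    (F.image (g⁻¹ : Equiv.Perm E)).image g = F := by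
  ext x; simp [Finset.mem_image]

lemma image_ssubset (g : Equiv.Perm E) {F F' : Finset E} (h : F ⊂ F') :
    F.image g ⊂ F'.image g :=
  (Finset.image_ssubset_image g.injective).2 h

lemma mact_image (g : Equiv.Perm E) (m : Finset E → ℕ) (F : Finset E) :
    mact g m (F.image g) = m F := by
  unfold mact
  rw [image_inv_image]

lemma prevFlat_mact (g : Equiv.Perm E) (m : Finset E → ℕ) (F : Finset E) :
    prevFlat (mact g m) (F.image g) = (prevFlat m F).image g := by
  ext x
  simp only [mem_prevFlat, Finset.mem_image]
  constructor
  · rintro ⟨F', h1, h2, h3⟩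
    refine ⟨g⁻¹ x, ⟨F'.image (g⁻¹ : Equiv.Perm E), h1, ?_, ?_⟩, by simp⟩
    · have := image_ssubset g⁻¹ h2
      rwa [image_inv_image] at this
    · exact Finset.mem_image_of_mem _ h3
  · rintro ⟨y, ⟨F', h1, h2, h3⟩, rfl⟩
    exact ⟨F'.image g, by rwa [mact_image], image_ssubset g h2, Finset.mem_image_of_mem _ h3⟩

lemma topFlat_mact (g : Equiv.Perm E) (m : Finset E → ℕ) :
    topFlat (mact g m) = (topFlat m).image g := by
  ext x
  simp only [mem_topFlat, Finset.mem_image]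
  constructor
  · rintro ⟨F', h1, h3⟩
    exact ⟨g⁻¹ x, ⟨F'.image (g⁻¹ : Equiv.Perm E), h1, Finset.mem_image_of_mem _ h3⟩, by simp⟩
  · rintro ⟨y, ⟨F', h1, h3⟩, rfl⟩
    exact ⟨F'.image g, by rwa [mact_image], Finset.mem_image_of_mem _ h3⟩

lemma univ_image (g : Equiv.Perm E) : (Finset.univ : Finset E).image g = Finset.univ :=
  Finset.image_univ_equiv g

lemma mact_single (g : Equiv.Perm E) (F : Finset E) :
    mact g (Pi.single F 1) = Pi.single (F.image g) 1 := by
  funext G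
  unfold mact
  by_cases h : G = F.image g
  · subst h; rw [image_inv_image]; simp
  · have : G.image (g⁻¹ : Equiv.Perm E) ≠ F := by
      rintro rfl; exact h (image_image_inv g G).symm
    rw [Pi.single_eq_of_ne this, Pi.single_eq_of_ne h]

/-- the sup of a chain is empty or a member -/
lemma chain_sup (S : Finset (Finset E)) (hS : ∀ F ∈ S, ∀ F' ∈ S, F ⊆ F' ∨ F' ⊆ F) :
    (S = ∅ ∧ S.sup id = ∅) ∨ S.sup id ∈ S := by
  induction S using Finset.induction_on with
  | empty => left; simp
  | insert a s ha ih =>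
    right
    rw [Finset.sup_insert]
    rcases ih (fun F hF F' hF' => hS F (Finset.mem_insert_of_mem hF) F'
      (Finset.mem_insert_of_mem hF')) with ⟨h, h'⟩ | h
    · rw [h']; simp
    · rcases hS a (Finset.mem_insert_self _ _) _ (Finset.mem_insert_of_mem h) with h1 | h1
      · have : id a ⊔ s.sup id = s.sup id := sup_eq_right.2 h1
        rw [this]; exact Finset.mem_insert_of_mem h
      · have : id a ⊔ s.sup id = a := sup_eq_left.2 h1
        rw [this]; exact Finset.mem_insert_self _ _

/-- telescoping along a chain -/
lemma chain_telescope (f : Finset E → ℤ) (h0 : f ∅ = 0) (S : Finset (Finset E)) :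
    (∀ F ∈ S, ∀ F' ∈ S, F ⊆ F' ∨ F' ⊆ F) →
    ∑ F ∈ S, (f F - f ((S.filter (· ⊂ F)).sup id)) = f (S.sup id) := by
  refine Finset.induction_on_max_value (ι := Finset E) Finset.card S ?_ ?_
  · intro; simp [h0]
  · intro a s ha hmax ih hS
    have ih' := ih (fun F hF F' hF' => hS F (Finset.mem_insert_of_mem hF) F'
      (Finset.mem_insert_of_mem hF'))
    have hlt : ∀ x ∈ s, x ⊂ a := by
      intro x hx
      have hne : x ≠ a := fun h => ha (h ▸ hx)
      rcases hS x (Finset.mem_insert_of_mem hx) a (Finset.mem_insert_self _ _) with h | h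
      · exact h.ssubset_of_ne hne
      · exact absurd (Finset.eq_of_subset_of_card_le h (hmax x hx)).symm hne
    rw [Finset.sum_insert ha]
    have e1 : (insert a s).filter (· ⊂ a) = s := by
      ext x
      simp only [Finset.mem_filter, Finset.mem_insert]
      constructor
      · rintro ⟨rfl | h, h'⟩
        · exact absurd h' (ssubset_irrefl _)
        · exact h
      · intro h; exact ⟨Or.inr h, hlt x h⟩
    have e2 : ∀ F ∈ s, (insert a s).filter (· ⊂ F) = s.filter (· ⊂ F) := by
      intro F hF
      ext x
      simp only [Finset.mem_filter, Finset.mem_insert]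
      constructor
      · rintro ⟨rfl | h, h'⟩
        · exact absurd (h'.trans (hlt F hF)) (ssubset_irrefl _)
        · exact ⟨h, h'⟩
      · rintro ⟨h, h'⟩; exact ⟨Or.inr h, h'⟩
    rw [Finset.sum_congr rfl (fun F hF => by rw [e2 F hF]), ih', e1, Finset.sup_insert]
    have : id a ⊔ s.sup id = a := sup_eq_left.2 (Finset.sup_le fun x hx => (hlt x hx).1)
    rw [this]; ring

lemma prevFlat_eq (m : Finset E → ℕ) (F : Finset E) :
    prevFlat m F = ((Finset.univ.filter fun F' => m F' ≠ 0).filter (· ⊂ F)).sup id := by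
  ext x
  rw [mem_prevFlat, Finset.mem_sup]
  simp [and_assoc]

lemma prevFlat_congr {m m' : Finset E → ℕ} (h : ∀ F, F ≠ Finset.univ → (m F ≠ 0 ↔ m' F ≠ 0))
    (F : Finset E) : prevFlat m F = prevFlat m' F := by
  ext x
  simp only [mem_prevFlat]
  refine exists_congr fun F' => ?_
  constructor
  · rintro ⟨h1, h2, h3⟩
    exact ⟨(h F' (fun e => by subst e; exact h2.2 (Finset.subset_univ _))).1 h1, h2, h3⟩
  · rintro ⟨h1, h2, h3⟩
    exact ⟨(h F' (fun e => by subst e; exact h2.2 (Finset.subset_univ _))).2 h1, h2, h3⟩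

variable (M : SimpleFlatMatroid E)

lemma rk_lt : ∀ n : ℕ, ∀ F ∈ M.flats, ∀ F' ∈ M.flats, F ⊂ F' → F'.card - F.card ≤ n →
    M.rk F < M.rk F' := by
  intro n
  induction n with
  | zero =>
    intro F _ F' _ h hn
    have := Finset.card_lt_card h
    omega
  | succ n ih =>
    intro F hF F' hF' h hn
    by_cases hc : ∃ F'' ∈ M.flats, F ⊂ F'' ∧ F'' ⊂ F'
    · obtain ⟨F'', h1, h2, h3⟩ := hc
      have c2 := Finset.card_lt_card h2
      have c3 := Finset.card_lt_card h3
      exact (ih F hF F'' h1 h2 (by omega)).trans (ih F'' h1 F' hF' h3 (by omega))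
    · have := M.rk_cover F hF F' hF' h hc
      omega

lemma rk_strict {F F' : Finset E} (hF : F ∈ M.flats) (hF' : F' ∈ M.flats) (h : F ⊂ F') :
    M.rk F < M.rk F' := M.rk_lt _ F hF F' hF' h le_rfl

lemma isAut_inv {g : Equiv.Perm E} (hg : M.IsAut g) : M.IsAut g⁻¹ := by
  have hsub : M.flats.image (fun F => F.image g) ⊆ M.flats := by
    intro F hF
    obtain ⟨F', h, rfl⟩ := Finset.mem_image.1 hF
    exact hg F' h
  have hinj : Function.Injective (fun F : Finset E => F.image g) :=
    Finset.image_injective g.injective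
  have heq := Finset.eq_of_subset_of_card_le hsub (by rw [Finset.card_image_of_injective _ hinj])
  intro F hF
  rw [← heq] at hF
  obtain ⟨F', h, rfl⟩ := Finset.mem_image.1 hF
  rwa [image_inv_image]

lemma rk_image_aux {g : Equiv.Perm E} (hg : M.IsAut g) : ∀ n : ℕ, ∀ F ∈ M.flats, F.card ≤ n →
    M.rk (F.image g) = M.rk F := by
  intro n
  induction n with
  | zero =>
    intro F _ h
    have : F = ∅ := by simpa using h
    simp [this]
  | succ n ih =>
    intro F hF hn
    by_cases h0 : F = ∅
    · simp [h0]
    · obtain ⟨F0, hF0, hmax⟩ := Finset.exists_max_image (M.flats.filter (· ⊂ F)) Finset.card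
        ⟨∅, by simp [M.empty_mem, Finset.empty_ssubset, Finset.nonempty_iff_ne_empty, h0]⟩
      rw [Finset.mem_filter] at hF0
      have c0 := Finset.card_lt_card hF0.2
      rw [M.rk_cover F0 hF0.1 F hF hF0.2 ?_, ← ih F0 hF0.1 (by omega)]
      · apply M.rk_cover _ (hg _ hF0.1) _ (hg _ hF) (image_ssubset g hF0.2)
        rintro ⟨F'', h1, h2, h3⟩
        have h2' := image_ssubset g⁻¹ h2
        have h3' := image_ssubset g⁻¹ h3
        rw [image_inv_image] at h2' h3'
        have := hmax _ (Finset.mem_filter.2 ⟨M.isAut_inv hg _ h1, h3'⟩)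
        have := Finset.card_lt_card h2'
        omega
      · rintro ⟨F'', h1, h2, h3⟩
        have := hmax _ (Finset.mem_filter.2 ⟨h1, h3⟩)
        have := Finset.card_lt_card h2
        omega

lemma rk_image {g : Equiv.Perm E} (hg : M.IsAut g) {F : Finset E} (hF : F ∈ M.flats) :
    M.rk (F.image g) = M.rk F := M.rk_image_aux hg _ F hF le_rfl

variable {M}

lemma IsFY.prev {m : Finset E → ℕ} (h : M.IsFY m) (F : Finset E) :
    prevFlat m F = ∅ ∨ (m (prevFlat m F) ≠ 0 ∧ prevFlat m F ⊂ F) := by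
  rw [prevFlat_eq]
  rcases chain_sup ((Finset.univ.filter fun F' => m F' ≠ 0).filter (· ⊂ F)) (by
    intro A hA B hB
    simp only [Finset.mem_filter] at hA hB
    exact h.2.1 A B hA.1.2 hB.1.2) with h1 | h1
  · exact Or.inl h1.2
  · right
    simpa only [Finset.mem_filter, Finset.mem_univ, true_and] using h1

lemma IsFY.prev_flat {m : Finset E → ℕ} (h : M.IsFY m) (F : Finset E) :
    prevFlat m F ∈ M.flats := by
  rcases h.prev F with h1 | h1
  · rw [h1]; exact M.empty_mem
  · exact (h.1 _ h1.1).1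

lemma IsFY.prev_univ {m : Finset E → ℕ} (h : M.IsFY m) {r : ℕ}
    (hr : M.rk Finset.univ = r + 1) : M.rk (prevFlat m Finset.univ) ≤ r := by
  rcases h.prev Finset.univ with h1 | h1
  · rw [h1, M.rk_empty]; omega
  · have := M.rk_strict (h.1 _ h1.1).1 M.ground_mem h1.2
    omega

variable (M)

/-- the duality involution -/
def dual (r : ℕ) (m : Finset E → ℕ) : Finset E → ℕ := fun F =>
  if F = Finset.univ then r - M.rk (prevFlat m Finset.univ) - m Finset.univ
  else if m F ≠ 0 then M.rk F - M.rk (prevFlat m F) - m F else 0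

variable {M}

lemma dual_ne {m : Finset E → ℕ} (h : M.IsFY m) (r : ℕ) (F : Finset E) (hF : F ≠ Finset.univ) :
    M.dual r m F ≠ 0 ↔ m F ≠ 0 := by
  unfold dual
  rw [if_neg hF]
  split_ifs with h1
  · have := h.2.2 F h1
    constructor
    · intro _; exact h1
    · intro _; omega
  · tauto

lemma prevFlat_dual {m : Finset E → ℕ} (h : M.IsFY m) (r : ℕ) (F : Finset E) :
    prevFlat (M.dual r m) F = prevFlat m F :=
  prevFlat_congr (fun F hF => dual_ne h r F hF) F

lemma dual_isFY {m : Finset E → ℕ} (h : M.IsFY m) {r : ℕ} (hr : M.rk Finset.univ = r + 1) :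
    M.IsFY (M.dual r m) := by
  have hne : (Finset.univ : Finset E) ≠ ∅ := by
    intro e
    rw [e, M.rk_empty] at hr
    omega
  refine ⟨fun F hF => ?_, fun F F' hF hF' => ?_, fun F hF => ?_⟩
  · by_cases hu : F = Finset.univ
    · rw [hu]; exact ⟨M.ground_mem, hne⟩
    · exact h.1 F ((dual_ne h r F hu).1 hF)
  · by_cases hu : F = Finset.univ
    · right; rw [hu]; exact Finset.subset_univ _
    by_cases hu' : F' = Finset.univ
    · left; rw [hu']; exact Finset.subset_univ _
    exact h.2.1 F F' ((dual_ne h r F hu).1 hF) ((dual_ne h r F' hu').1 hF')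
  · rw [prevFlat_dual h]
    by_cases hu : F = Finset.univ
    · subst hu
      have := h.prev_univ hr
      simp only [dual, if_true]
      omega
    · have h1 := (dual_ne h r F hu).1 hF
      have h2 := h.2.2 F h1
      simp only [dual, if_neg hu, if_pos h1]
      omega

lemma dual_dual {m : Finset E → ℕ} (h : M.IsFY m) {r : ℕ} (hr : M.rk Finset.univ = r + 1) :
    M.dual r (M.dual r m) = m := by
  funext F
  by_cases hu : F = Finset.univ
  · subst hu
    have h1 := h.prev_univ hr
    have h2 := h.2.2 Finset.univ
    have e : M.dual r (M.dual r m) Finset.univ =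
        r - M.rk (prevFlat (M.dual r m) Finset.univ) - M.dual r m Finset.univ := by
      rw [dual, if_pos rfl]
    have e' : M.dual r m Finset.univ =
        r - M.rk (prevFlat m Finset.univ) - m Finset.univ := by
      rw [dual, if_pos rfl]
    rw [e, e', prevFlat_dual h]
    by_cases h3 : m Finset.univ = 0
    · omega
    · have := h2 h3
      omega
  · have e : M.dual r (M.dual r m) F = if M.dual r m F ≠ 0 then
        M.rk F - M.rk (prevFlat (M.dual r m) F) - M.dual r m F else 0 := by
      rw [dual, if_neg hu]
    have e' : M.dual r m F = if m F ≠ 0 then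
        M.rk F - M.rk (prevFlat m F) - m F else 0 := by
      rw [dual, if_neg hu]
    rw [e]
    by_cases h1 : m F ≠ 0
    · rw [if_pos ((dual_ne h r F hu).2 h1), prevFlat_dual h, e', if_pos h1]
      have := h.2.2 F h1
      omega
    · rw [if_neg (fun h' => h1 ((dual_ne h r F hu).1 h'))]
      omega

lemma deg_dual {m : Finset E → ℕ} (h : M.IsFY m) {r : ℕ} (hr : M.rk Finset.univ = r + 1) :
    deg (M.dual r m) + deg m = r := by
  have hu1 := h.prev_univ hr
  have hu2 := h.2.2 Finset.univ
  set S : Finset (Finset E) := Finset.univ.filter fun F => m F ≠ 0 with hS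
  set P : Finset (Finset E) := S.filter (· ⊂ Finset.univ) with hP
  have hmemP : ∀ F, F ∈ P ↔ m F ≠ 0 ∧ F ≠ Finset.univ := by
    intro F
    simp [hP, hS, Finset.ssubset_univ_iff]
  have htel := chain_telescope (fun F => (M.rk F : ℤ)) (by simp [M.rk_empty]) P (by
    intro F hF F' hF'
    exact h.2.1 F F' ((hmemP F).1 hF).1 ((hmemP F').1 hF').1)
  have hprev : prevFlat m Finset.univ = P.sup id := prevFlat_eq m _
  have hprev' : ∀ F, prevFlat m F = (P.filter (· ⊂ F)).sup id := by
    intro F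
    rw [prevFlat_eq]
    congr 1
    ext x
    simp only [Finset.mem_filter, hmemP, Finset.mem_univ, true_and]
    constructor
    · rintro ⟨a, b⟩
      exact ⟨⟨a, fun e => by subst e; exact b.2 (Finset.subset_univ _)⟩, b⟩
    · rintro ⟨⟨a, _⟩, b⟩; exact ⟨a, b⟩
  rw [← hprev] at htel
  have hsum : deg (M.dual r m) + deg m = ∑ F : Finset E, (M.dual r m F + m F) := by
    unfold deg; rw [Finset.sum_add_distrib]
  have hsplit : ∑ F : Finset E, (M.dual r m F + m F) =
      (M.dual r m Finset.univ + m Finset.univ) + ∑ F ∈ P, (M.dual r m F + m F) := by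
    have hnot : (Finset.univ : Finset E) ∉ P := fun hh => ((hmemP _).1 hh).2 rfl
    rw [← Finset.sum_insert (f := fun F => M.dual r m F + m F) hnot]
    symm
    apply Finset.sum_subset (Finset.subset_univ _)
    intro F _ hF
    rw [Finset.mem_insert, not_or, hmemP] at hF
    have : m F = 0 := by
      by_contra h0
      exact hF.2 ⟨h0, hF.1⟩
    simp [dual, hF.1, this]
  have hu : M.dual r m Finset.univ + m Finset.univ = r - M.rk (prevFlat m Finset.univ) := by
    rw [dual, if_pos rfl]
    by_cases h3 : m Finset.univ = 0
    · omega
    · have := hu2 h3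
      omega
  have hp : ((∑ F ∈ P, (M.dual r m F + m F) : ℕ) : ℤ) = M.rk (prevFlat m Finset.univ) := by
    rw [← htel]
    push_cast
    apply Finset.sum_congr rfl
    intro F hF
    obtain ⟨h1, h2⟩ := (hmemP F).1 hF
    rw [← hprev']
    have h3 := h.2.2 F h1
    rw [dual, if_neg h2, if_pos h1]
    omega
  rw [hsum, hsplit, hu]
  omega

lemma dual_mact {m : Finset E → ℕ} (h : M.IsFY m) (r : ℕ) {g : Equiv.Perm E} (hg : M.IsAut g) :
    M.dual r (mact g m) = mact g (M.dual r m) := by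
  funext G
  obtain ⟨F, rfl⟩ : ∃ F : Finset E, F.image g = G := ⟨_, image_image_inv g G⟩
  rw [mact_image]
  unfold dual
  have hiff : F.image g = Finset.univ ↔ F = Finset.univ := by
    constructor
    · intro e
      rw [← univ_image g] at e
      exact Finset.image_injective g.injective e
    · rintro rfl; exact univ_image g
  by_cases hu : F = Finset.univ
  · rw [if_pos (hiff.2 hu), if_pos hu]
    have e1 := prevFlat_mact g m Finset.univ
    have e2 := mact_image g m Finset.univ
    rw [univ_image] at e1 e2
    rw [e1, e2, M.rk_image hg (h.prev_flat _)]
  · rw [if_neg (fun e => hu (hiff.1 e)), if_neg hu, mact_image, prevFlat_mact,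
      M.rk_image hg (h.prev_flat _)]
    split_ifs with h1
    · rw [M.rk_image hg (h.1 F h1).1]
    · rfl

variable (M)

/-- equivariant embedding of `FY^a` into `FY^b` -/
def Emb (a b : ℕ) : Prop :=
  ∃ f : M.FYk a → M.FYk b, Function.Injective f ∧
    ∀ g : Equiv.Perm E, M.IsAut g → ∀ x y : M.FYk a,
      (y : Finset E → ℕ) = mact g (x : Finset E → ℕ) →
      (f y : Finset E → ℕ) = mact g (f x : Finset E → ℕ)

variable {M}

lemma Emb.rfl' (a : ℕ) : M.Emb a a :=
  ⟨id, Function.injective_id, fun _ _ _ _ h => h⟩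

lemma Emb.trans {a b c : ℕ} (h : M.Emb a b) (h' : M.Emb b c) : M.Emb a c := by
  obtain ⟨f, hf, hf'⟩ := h
  obtain ⟨f', hf1, hf1'⟩ := h'
  exact ⟨f' ∘ f, hf1.comp hf, fun g hg x y hxy => hf1' g hg _ _ (hf' g hg x y hxy)⟩

lemma emb_dual {r : ℕ} (hr : M.rk Finset.univ = r + 1) {a b : ℕ} (hab : a + b = r) :
    M.Emb a b := by
  refine ⟨fun x => ⟨M.dual r x.1, dual_isFY x.2.1 hr, ?_⟩, ?_, ?_⟩
  · have h1 := deg_dual x.2.1 hr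
    have h2 := x.2.2
    omega
  · intro x y hxy
    have := congrArg (fun z : M.FYk b => M.dual r z.1) hxy
    simp only [dual_dual x.2.1 hr, dual_dual y.2.1 hr] at this
    exact Subtype.ext this
  · intro g hg x y hxy
    simp only
    rw [hxy, dual_mact x.2.1 r hg]

lemma deg_add (m m' : Finset E → ℕ) : deg (m + m') = deg m + deg m' := by
  simp [deg, Finset.sum_add_distrib]

lemma deg_single (F : Finset E) : deg (Pi.single F 1 : Finset E → ℕ) = 1 := by
  simp [deg]

lemma deg_zero_eq {m : Finset E → ℕ} (h : deg m = 0) : m = 0 := by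
  funext F
  have := (Finset.sum_eq_zero_iff (s := Finset.univ) (f := m)).1 h F (Finset.mem_univ _)
  simpa using this

/-- splitting off a variable -/
lemma split_off {m : Finset E → ℕ} {F : Finset E} (h : m F ≠ 0) {n : ℕ} (hd : deg m = n + 1) :
    m = (m - Pi.single F 1) + Pi.single F 1 ∧ deg (m - Pi.single F 1) = n := by
  have e : m = (m - Pi.single F 1) + Pi.single F 1 := by
    funext G
    by_cases hG : G = F
    · subst hG; simp; omega
    · simp [Pi.single_apply, hG]
  refine ⟨e, ?_⟩
  have h1 := deg_add (m - Pi.single F 1) (Pi.single F 1)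
  rw [← e, deg_single] at h1
  omega

lemma deg_one {m : Finset E → ℕ} (h : deg m = 1) : ∃ F, m = Pi.single F 1 := by
  have : ∃ F, m F ≠ 0 := by
    by_contra hc
    push Not at hc
    have : deg m = 0 := Finset.sum_eq_zero fun F _ => hc F
    omega
  obtain ⟨F, hF⟩ := this
  obtain ⟨e, hd⟩ := split_off hF (n := 0) h
  refine ⟨F, ?_⟩
  rw [e, deg_zero_eq hd, zero_add]

lemma single_isFY {F : Finset E} (hF : F ∈ M.flats) (h2 : 2 ≤ M.rk F) :
    M.IsFY (Pi.single F 1) := by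
  have hs : ∀ G, (Pi.single F 1 : Finset E → ℕ) G ≠ 0 → G = F := by
    intro G hG
    by_contra hc
    exact hG (by simp [Pi.single_apply, hc])
  refine ⟨?_, ?_, ?_⟩
  · intro G hG
    rw [hs G hG]
    refine ⟨hF, ?_⟩
    rintro rfl
    rw [M.rk_empty] at h2; omega
  · intro G G' hG hG'
    rw [hs G hG, hs G' hG']; simp
  · intro G hG
    have e := hs G hG
    subst e
    have : prevFlat (Pi.single G 1 : Finset E → ℕ) G = ∅ := by
      ext x
      rw [mem_prevFlat]
      simp only [Finset.notMem_empty, iff_false]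
      rintro ⟨F', h1, h3, -⟩
      rw [hs F' h1] at h3
      exact ssubset_irrefl _ h3
    rw [this, M.rk_empty]
    simp; omega

/-- two-variable monomials -/
lemma pair_isFY {F G : Finset E} (hF : F ∈ M.flats) (hG : G ∈ M.flats) (h : F ⊂ G)
    (h2 : 2 ≤ M.rk F) (h3 : M.rk F + 2 ≤ M.rk G) :
    M.IsFY (Pi.single F 1 + Pi.single G 1) := by
  have hne : F ≠ G := h.ne
  have hs : ∀ H, (Pi.single F 1 + Pi.single G 1 : Finset E → ℕ) H ≠ 0 ↔ H = F ∨ H = G := by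
    intro H
    simp only [Pi.add_apply, Pi.single_apply]
    split_ifs <;> simp_all
  refine ⟨?_, ?_, ?_⟩
  · intro H hH
    have hF0 : F ≠ ∅ := by
      rintro rfl
      rw [M.rk_empty] at h2; omega
    have hG0 : G ≠ ∅ := by
      rintro rfl
      rw [M.rk_empty] at h3; omega
    rcases (hs H).1 hH with rfl | rfl
    · exact ⟨hF, hF0⟩
    · exact ⟨hG, hG0⟩
  · intro H H' hH hH'
    rcases (hs H).1 hH with rfl | rfl <;> rcases (hs H').1 hH' with rfl | rfl
    · simp
    · exact Or.inl h.1
    · exact Or.inr h.1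
    · simp
  · intro H hH
    rcases (hs H).1 hH with rfl | rfl
    · have : prevFlat (Pi.single H 1 + Pi.single G 1 : Finset E → ℕ) H = ∅ := by
        ext x
        rw [mem_prevFlat]
        simp only [Finset.notMem_empty, iff_false]
        rintro ⟨F', h1, h4, -⟩
        rcases (hs F').1 h1 with rfl | rfl
        · exact ssubset_irrefl _ h4
        · exact ssubset_irrefl _ (h4.trans h)
      rw [this, M.rk_empty]
      simp [Pi.single_apply, hne]; omega
    · have : prevFlat (Pi.single F 1 + Pi.single H 1 : Finset E → ℕ) H = F := by
        ext x
        rw [mem_prevFlat]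
        constructor
        · rintro ⟨F', h1, h3, h4⟩
          rcases (hs F').1 h1 with rfl | rfl
          · exact h4
          · exact absurd h3 (ssubset_irrefl _)
        · intro hx
          exact ⟨F, (hs F).2 (Or.inl rfl), h, hx⟩
      rw [this]
      simp [Pi.single_apply, hne.symm]; omega

lemma square_isFY {F : Finset E} (hF : F ∈ M.flats) (h2 : 3 ≤ M.rk F) :
    M.IsFY (Pi.single F 1 + Pi.single F 1) := by
  have hs : ∀ G, (Pi.single F 1 + Pi.single F 1 : Finset E → ℕ) G ≠ 0 → G = F := by
    intro G hG
    by_contra hc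
    exact hG (by simp [Pi.single_apply, hc])
  refine ⟨?_, ?_, ?_⟩
  · intro G hG
    rw [hs G hG]
    refine ⟨hF, ?_⟩
    rintro rfl
    rw [M.rk_empty] at h2; omega
  · intro G G' hG hG'
    rw [hs G hG, hs G' hG']; simp
  · intro G hG
    have e := hs G hG
    subst e
    have : prevFlat (Pi.single G 1 + Pi.single G 1 : Finset E → ℕ) G = ∅ := by
      ext x
      rw [mem_prevFlat]
      simp only [Finset.notMem_empty, iff_false]
      rintro ⟨F', h1, h3, -⟩
      rw [hs F' h1] at h3
      exact ssubset_irrefl _ h3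
    rw [this, M.rk_empty]
    simp; omega

lemma IsFY.two_le {m : Finset E → ℕ} (h : M.IsFY m) {F : Finset E} (hF : m F ≠ 0) :
    2 ≤ M.rk F := by
  have := h.2.2 F hF
  omega

lemma emb_zero_one {r : ℕ} (hr : M.rk Finset.univ = r + 1) (h1 : 1 ≤ r) : M.Emb 0 1 := by
  refine ⟨fun _ => ⟨Pi.single Finset.univ 1,
    single_isFY M.ground_mem (by omega), deg_single _⟩, ?_, ?_⟩
  · intro x y _
    exact Subtype.ext ((deg_zero_eq x.2.2).trans (deg_zero_eq y.2.2).symm)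
  · intro g _ x y _
    simp only
    rw [mact_single, univ_image]

lemma fy_one (x : M.FYk 1) : ∃ F, F ∈ M.flats ∧ 2 ≤ M.rk F ∧
    (x : Finset E → ℕ) = Pi.single F 1 := by
  obtain ⟨F, hF⟩ := deg_one x.2.2
  have h : (x : Finset E → ℕ) F ≠ 0 := by rw [hF]; simp
  exact ⟨F, (x.2.1.1 F h).1, x.2.1.two_le h, hF⟩

lemma single_inj {F G : Finset E} (h : (Pi.single F 1 : Finset E → ℕ) = Pi.single G 1) :
    F = G := by
  by_contra hc
  have := congrFun h F
  simp [Pi.single_apply, hc] at this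

/-- companion flat in the map `FY^1 → FY^2` -/
def comp (r : ℕ) (F : Finset E) (M : SimpleFlatMatroid E) : Finset E :=
  if M.rk F = r then F else Finset.univ

lemma comp_isFY {r : ℕ} (hr : M.rk Finset.univ = r + 1) (h4 : 4 ≤ r) {F : Finset E}
    (hF : F ∈ M.flats) (h2 : 2 ≤ M.rk F) :
    M.IsFY (Pi.single F 1 + Pi.single (comp r F M) 1) := by
  unfold comp
  split_ifs with h
  · exact square_isFY hF (by omega)
  · by_cases hu : F = Finset.univ
    · rw [hu]; exact square_isFY M.ground_mem (by omega)
    · have hss := Finset.ssubset_univ_iff.2 hu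
      have := M.rk_strict hF M.ground_mem hss
      exact pair_isFY hF M.ground_mem hss h2 (by omega)

lemma emb_one_two {r : ℕ} (hr : M.rk Finset.univ = r + 1) (h4 : 4 ≤ r) : M.Emb 1 2 := by
  choose s hs1 hs2 hs3 using fy_one (M := M)
  refine ⟨fun x => ⟨Pi.single (s x) 1 + Pi.single (comp r (s x) M) 1,
    comp_isFY hr h4 (hs1 x) (hs2 x), by rw [deg_add, deg_single, deg_single]⟩, ?_, ?_⟩
  · intro x y hxy
    have hxy' := congrArg Subtype.val hxy
    simp only at hxy'
    apply Subtype.ext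
    rw [hs3 x, hs3 y]
    congr 1
    have hU : ∀ F : Finset E, M.rk F = r → F ≠ Finset.univ := by
      rintro F hF rfl; omega
    unfold comp at hxy'
    split_ifs at hxy' with ha hb hb
    · by_contra hc
      have := congrFun hxy' (s x)
      simp [Pi.single_apply, hc] at this
    · exfalso
      have := congrFun hxy' Finset.univ
      simp [Pi.single_apply, (hU _ ha).symm] at this
    · exfalso
      have := congrFun hxy' Finset.univ
      simp [Pi.single_apply, (hU _ hb).symm] at this
    · exact single_inj (add_right_cancel hxy')
  · intro g hg x y hxy
    have e : s y = (s x).image g := by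
      apply single_inj
      rw [← hs3 y, hxy, hs3 x, mact_single]
    have e' : comp r (s y) M = (comp r (s x) M).image g := by
      unfold comp
      rw [e, M.rk_image hg (hs1 x)]
      split_ifs
      · rfl
      · rw [univ_image]
    have hadd : ∀ a b : Finset E → ℕ, mact g (a + b) = mact g a + mact g b := fun _ _ => rfl
    simp only
    rw [hadd, mact_single, mact_single, e', e]

lemma topFlat_mem {m : Finset E → ℕ} (h : M.IsFY m) (hd : deg m ≠ 0) : m (topFlat m) ≠ 0 := by
  rcases chain_sup (Finset.univ.filter fun F' => m F' ≠ 0) (by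
    intro A hA B hB
    simp only [Finset.mem_filter] at hA hB
    exact h.2.1 A B hA.2 hB.2) with h1 | h1
  · exfalso
    apply hd
    apply Finset.sum_eq_zero
    intro F _
    by_contra hc
    have : F ∈ (Finset.univ.filter fun F' => m F' ≠ 0) := by simp [hc]
    rw [h1.1] at this
    simp at this
  · exact (Finset.mem_filter.1 h1).2

lemma split_two : ∃ f : M.FYk 2 → M.FYk 1 × M.FYk 1, Function.Injective f ∧
    ∀ g : Equiv.Perm E, M.IsAut g → ∀ x y : M.FYk 2,
      (y : Finset E → ℕ) = mact g (x : Finset E → ℕ) →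
      ((f y).1 : Finset E → ℕ) = mact g ((f x).1 : Finset E → ℕ) ∧
      ((f y).2 : Finset E → ℕ) = mact g ((f x).2 : Finset E → ℕ) := by
  have htop : ∀ x : M.FYk 2, x.1 (topFlat x.1) ≠ 0 := fun x =>
    topFlat_mem x.2.1 (by rw [x.2.2]; omega)
  have hsp := fun x : M.FYk 2 => split_off (htop x) x.2.2
  have hfy : ∀ x : M.FYk 2, M.IsFY (x.1 - Pi.single (topFlat x.1) 1) := by
    intro x
    obtain ⟨F, hF⟩ := deg_one (hsp x).2
    have h : x.1 F ≠ 0 := by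
      rw [(hsp x).1, hF]; simp
    rw [hF]
    exact single_isFY (x.2.1.1 F h).1 (x.2.1.two_le h)
  refine ⟨fun x => (⟨x.1 - Pi.single (topFlat x.1) 1, hfy x, (hsp x).2⟩,
    ⟨Pi.single (topFlat x.1) 1, single_isFY (x.2.1.1 _ (htop x)).1 (x.2.1.two_le (htop x)),
      deg_single _⟩), ?_, ?_⟩
  · intro x y hxy
    have h1 := congrArg (fun z : M.FYk 1 × M.FYk 1 => z.1.1 + z.2.1) hxy
    simp only at h1
    rw [← (hsp x).1, ← (hsp y).1] at h1
    exact Subtype.ext h1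
  · intro g _ x y hxy
    have hsub : ∀ a b : Finset E → ℕ, mact g (a - b) = mact g a - mact g b := fun _ _ => rfl
    simp only
    rw [hsub, mact_single, hxy, topFlat_mact]
    exact ⟨rfl, rfl⟩

lemma emb_low {r : ℕ} (hr : M.rk Finset.univ = r + 1) (hr6 : r + 1 ≤ 6) {p q : ℕ}
    (hpq : p ≤ q) (hq : 2 * q ≤ r) : M.Emb p q := by
  have hq2 : q ≤ 2 := by omega
  interval_cases q
  · interval_cases p
    exact Emb.rfl' _
  · interval_cases p
    · exact emb_zero_one hr (by omega)
    · exact Emb.rfl' _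
  · interval_cases p
    · exact (emb_zero_one hr (by omega)).trans (emb_one_two hr (by omega))
    · exact emb_one_two hr (by omega)
    · exact Emb.rfl' _

lemma emb_min {r : ℕ} (hr : M.rk Finset.univ = r + 1) {a : ℕ} (ha : a ≤ r) :
    M.Emb a (min a (r - a)) ∧ M.Emb (min a (r - a)) a := by
  rcases le_total a (r - a) with h | h
  · rw [min_eq_left h]; exact ⟨Emb.rfl' _, Emb.rfl' _⟩
  · rw [min_eq_right h]; exact ⟨emb_dual hr (by omega), emb_dual hr (by omega)⟩

lemma emb_all {r : ℕ} (hr : M.rk Finset.univ = r + 1) (hr6 : r + 1 ≤ 6) {a b : ℕ}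
    (ha : a ≤ r) (hb : b ≤ r) (h : min a (r - a) ≤ min b (r - b)) : M.Emb a b :=
  (emb_min hr ha).1.trans ((emb_low hr hr6 h (by omega)).trans (emb_min hr hb).2)

variable (M)

/-- the conclusion of the theorem -/
def Emb2 (i l j k : ℕ) : Prop :=
    ∃ φ : M.FYk i × M.FYk l → M.FYk j × M.FYk k,
      Function.Injective φ ∧
      ∀ g : Equiv.Perm E, M.IsAut g → ∀ x y : M.FYk i × M.FYk l,
        ((y.1 : Finset E → ℕ) = mact g (x.1 : Finset E → ℕ) ∧
         (y.2 : Finset E → ℕ) = mact g (x.2 : Finset E → ℕ)) →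
        ((φ y).1 : Finset E → ℕ) = mact g ((φ x).1 : Finset E → ℕ) ∧
        ((φ y).2 : Finset E → ℕ) = mact g ((φ x).2 : Finset E → ℕ)

variable {M}

lemma Emb2.of_emb {i l j k : ℕ} (h1 : M.Emb i j) (h2 : M.Emb l k) : M.Emb2 i l j k := by
  obtain ⟨f, hf, hf'⟩ := h1
  obtain ⟨f2, hf2, hf2'⟩ := h2
  exact ⟨Prod.map f f2, hf.prodMap hf2,
    fun g hg x y hxy => ⟨hf' g hg _ _ hxy.1, hf2' g hg _ _ hxy.2⟩⟩

lemma Emb2.swap {i l j k : ℕ} (h : M.Emb2 i l j k) : M.Emb2 l i j k := by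
  obtain ⟨f, hf, hf'⟩ := h
  exact ⟨f ∘ Prod.swap, hf.comp Prod.swap_injective,
    fun g hg x y hxy => hf' g hg _ _ ⟨hxy.2, hxy.1⟩⟩

lemma Emb2.trans {i l j k j' k' : ℕ} (h : M.Emb2 i l j k) (h' : M.Emb2 j k j' k') :
    M.Emb2 i l j' k' := by
  obtain ⟨f, hf, hf1⟩ := h
  obtain ⟨f', hf', hf1'⟩ := h'
  exact ⟨f' ∘ f, hf'.comp hf, fun g hg x y hxy => hf1' g hg _ _ (hf1 g hg _ _ hxy)⟩

lemma emb2_zero_two : M.Emb2 0 2 1 1 := by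
  obtain ⟨f, hf, hf'⟩ := split_two (M := M)
  refine ⟨fun x => f x.2, ?_, fun g hg x y hxy => hf' g hg _ _ hxy.2⟩
  intro x y hxy
  exact Prod.ext (Subtype.ext ((deg_zero_eq x.1.2.2).trans (deg_zero_eq y.1.2.2).symm)) (hf hxy)

end Helpers

end SimpleFlatMatroid

open SimpleFlatMatroid in
/-- Let `M` be a finite simple matroid of rank `r+1 ≤ 6` with automorphism group `G`.
Then for all `0 ≤ i ≤ j ≤ k ≤ l ≤ r` with `i + l = j + k` there is a `G`-equivariant
injection `FY^i × FY^l → FY^j × FY^k` (diagonal actions); i.e. the sequence of `G`-sets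
`(FY^0, …, FY^r)` is Burnside `PF₂`. -/
theorem fy_burnside_pf2_small_rank {E : Type*} [Fintype E] [DecidableEq E]
    (M : SimpleFlatMatroid E) (r : ℕ) (hr : M.rk Finset.univ = r + 1)
    (hr6 : r + 1 ≤ 6) :
    ∀ i j k l : ℕ, i ≤ j → j ≤ k → k ≤ l → l ≤ r → i + l = j + k →
    ∃ φ : M.FYk i × M.FYk l → M.FYk j × M.FYk k,
      Function.Injective φ ∧
      ∀ g : Equiv.Perm E, M.IsAut g → ∀ x y : M.FYk i × M.FYk l,
        ((y.1 : Finset E → ℕ) = mact g (x.1 : Finset E → ℕ) ∧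
         (y.2 : Finset E → ℕ) = mact g (x.2 : Finset E → ℕ)) →
        ((φ y).1 : Finset E → ℕ) = mact g ((φ x).1 : Finset E → ℕ) ∧
        ((φ y).2 : Finset E → ℕ) = mact g ((φ x).2 : Finset E → ℕ) := by
  intro i j k l hij hjk hkl hl hs
  change M.Emb2 i l j k
  by_cases h1 : min i (r - i) ≤ min j (r - j) ∧ min l (r - l) ≤ min k (r - k)
  · exact Emb2.of_emb (emb_all hr hr6 (by omega) (by omega) h1.1)
      (emb_all hr hr6 (by omega) (by omega) h1.2)
  by_cases h2 : min i (r - i) ≤ min k (r - k) ∧ min l (r - l) ≤ min j (r - j)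
  · exact (Emb2.of_emb (emb_all hr hr6 (by omega) (by omega) h2.2)
      (emb_all hr hr6 (by omega) (by omega) h2.1)).swap
  by_cases h3 : i = 0
  · have : j = 1 ∧ k = 1 ∧ l = 2 := by omega
    obtain ⟨rfl, rfl, rfl⟩ := this
    subst h3
    exact emb2_zero_two
  · have : l = r ∧ j + 1 = r ∧ k + 1 = r ∧ i + 2 = r := by omega
    obtain ⟨e1, e2, e3, e4⟩ := this
    have a : M.Emb2 l i 0 2 := Emb2.of_emb (emb_dual hr (by omega)) (emb_dual hr (by omega))
    have b : M.Emb2 1 1 j k := Emb2.of_emb (emb_dual hr (by omega)) (emb_dual hr (by omega))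
    exact ((a.trans emb2_zero_two).trans b).swap
end

section
/- Let M be the Boolean matroid of rank 4 on E = {1,2,3,4} (every subset of E is a flat and rk(F) = |F|), so G = Aut(M) = S₄ and r = 3. Let g ∈ S₄ be any 4-cycle. Then each of the G-sets FY¹, FY², FY³ has exactly one g-fixed point, so the number of g-fixed points of FY¹ × FY¹ × FY² is 1 while the number of g-fixed points of (FY¹ × FY³) ⊔ (FY² × FY²) is 2; consequently there exists no S₄-equivariant injection (FY¹ × FY³) ⊔ (FY² × FY²) → FY¹ × FY¹ × FY². In particular, the sequence of S₄-sets (FY⁰, FY¹, FY², FY³) is not Burnside PF₃. -/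
open Finset

namespace SimpleFlatMatroid

variable {E : Type*} [Fintype E] [DecidableEq E] {M : SimpleFlatMatroid E}

/-- `y` is the image of `x` under the permutation `g`, for elements of `FY^u`. -/
def rel1 {u : ℕ} (g : Equiv.Perm E) (x y : M.FYk u) : Prop :=
  (y : Finset E → ℕ) = mact g (x : Finset E → ℕ)

/-- `y = g • x` for the diagonal action on `FY^u × FY^v`. -/
def rel2 {u v : ℕ} (g : Equiv.Perm E) (x y : M.FYk u × M.FYk v) : Prop :=
  rel1 g x.1 y.1 ∧ rel1 g x.2 y.2

/-- `y = g • x` for the diagonal action on `FY^u × FY^v × FY^w`. -/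
def rel3 {u v w : ℕ} (g : Equiv.Perm E) (x y : M.FYk u × M.FYk v × M.FYk w) : Prop :=
  rel1 g x.1 y.1 ∧ rel1 g x.2.1 y.2.1 ∧ rel1 g x.2.2 y.2.2

/-- `y = g • x` for the componentwise action on a disjoint union. -/
def relSum {A B : Type*} (rA : A → A → Prop) (rB : B → B → Prop) :
    A ⊕ B → A ⊕ B → Prop
  | .inl a, .inl a' => rA a a'
  | .inr b, .inr b' => rB b b'
  | _, _ => False

end SimpleFlatMatroid

namespace SimpleFlatMatroid

/-- A nonempty subset stable under a 4-cycle is everything. -/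
lemma stable_eq_univ (g : Equiv.Perm (Fin 4)) (hg : g.IsCycle ∧ g.support = Finset.univ)
    (F : Finset (Fin 4)) (hne : F ≠ ∅) (hF : F.image (g⁻¹ : Equiv.Perm (Fin 4)) = F) :
    F = Finset.univ := by
  have hmv : ∀ x, g x ≠ x := fun x => by
    have : x ∈ g.support := by rw [hg.2]; exact Finset.mem_univ x
    exact Equiv.Perm.mem_support.mp this
  have hst : ∀ x ∈ F, g x ∈ F := by
    intro x hx
    rw [← hF] at hx
    obtain ⟨y, hy, rfl⟩ := Finset.mem_image.mp hx
    simpa using hy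
  have hpow : ∀ n : ℕ, ∀ x ∈ F, (g ^ n) x ∈ F := by
    intro n
    induction n with
    | zero => intro x hx; simpa using hx
    | succ n ih =>
      intro x hx
      rw [pow_succ, Equiv.Perm.mul_apply]
      exact ih _ (hst x hx)
  obtain ⟨x, hx⟩ := Finset.nonempty_iff_ne_empty.mpr hne
  refine Finset.eq_univ_of_forall fun y => ?_
  obtain ⟨i, rfl⟩ := hg.1.exists_pow_eq (hmv x) (hmv y)
  exact hpow i x hx

/-- A fixed FY-monomial is a power of the variable of the ground set. -/
lemma fixed_eq_single (M : SimpleFlatMatroid (Fin 4))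
    (g : Equiv.Perm (Fin 4)) (hg : g.IsCycle ∧ g.support = Finset.univ) (k : ℕ)
    (a : M.FYk k) (ha : rel1 g a a) :
    (a : Finset (Fin 4) → ℕ) = Pi.single Finset.univ k := by
  rcases a with ⟨m, hm, hd⟩
  obtain ⟨h1, h2, -⟩ := id hm
  have hfix : ∀ F, m F = m (F.image (g⁻¹ : Equiv.Perm (Fin 4))) := fun F => congrFun ha F
  have hz : ∀ F, F ≠ Finset.univ → m F = 0 := by
    intro F hF
    by_contra hm
    have hm' := hm
    rw [hfix] at hm'
    have hc : (F.image (g⁻¹ : Equiv.Perm (Fin 4))).card = F.card :=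
      Finset.card_image_of_injective _ (Equiv.injective _)
    apply hF
    apply stable_eq_univ g hg F (h1 F hm).2
    rcases h2 F _ hm hm' with h | h
    · exact (Finset.eq_of_subset_of_card_le h hc.le).symm
    · exact Finset.eq_of_subset_of_card_le h hc.ge
  have hu : m Finset.univ = k := by
    rw [← hd, deg]
    exact (Finset.sum_eq_single _ (fun F _ h => hz F h) (by simp)).symm
  funext F
  by_cases hF : F = Finset.univ
  · subst hF; simpa using hu
  · simpa [Pi.single_apply, hF] using hz F hF

/-- The power `x_E ^ k` is an FY-monomial for `k ≤ 3`. -/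
lemma single_isFY_s17 (M : SimpleFlatMatroid (Fin 4)) (hflats : M.flats = Finset.univ)
    (hrank : ∀ F : Finset (Fin 4), M.rk F = F.card) (k : ℕ) (hk : k ≤ 3) :
    M.IsFY (Pi.single Finset.univ k) ∧
      deg (Pi.single Finset.univ k : Finset (Fin 4) → ℕ) = k := by
  have hs : ∀ F : Finset (Fin 4),
      (Pi.single Finset.univ k : Finset (Fin 4) → ℕ) F ≠ 0 → F = Finset.univ := by
    intro F h
    by_contra hF
    exact h (by simp [Pi.single_apply, hF])
  refine ⟨⟨?_, ?_, ?_⟩, ?_⟩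
  · intro F h
    rw [hs F h, hflats]
    exact ⟨Finset.mem_univ _, Finset.univ_nonempty.ne_empty⟩
  · intro F F' h h'
    rw [hs F h, hs F' h']
    exact Or.inl subset_rfl
  · intro F h
    have hp : prevFlat (Pi.single Finset.univ k : Finset (Fin 4) → ℕ) F = ∅ := by
      rw [prevFlat, ← Finset.bot_eq_empty, Finset.sup_eq_bot_iff]
      intro F' _
      rw [if_neg]
      rintro ⟨h', hlt⟩
      rw [hs F h, hs F' h'] at hlt
      exact hlt.ne rfl
    rw [hp, M.rk_empty, hrank, hs F h]
    simp
    omega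
  · rw [deg, Finset.sum_eq_single Finset.univ]
    · simp
    · intro F _ hF; simp [Pi.single_apply, hF]
    · simp

lemma existsUnique_fixed (M : SimpleFlatMatroid (Fin 4)) (hflats : M.flats = Finset.univ)
    (hrank : ∀ F : Finset (Fin 4), M.rk F = F.card)
    (g : Equiv.Perm (Fin 4)) (hg : g.IsCycle ∧ g.support = Finset.univ)
    (k : ℕ) (hk : k ≤ 3) : ∃! a : M.FYk k, rel1 g a a := by
  refine ⟨⟨_, single_isFY_s17 M hflats hrank k hk⟩, ?_, ?_⟩
  · change (Pi.single Finset.univ k : Finset (Fin 4) → ℕ) = mact g _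
    funext F
    have hiff : F.image (g⁻¹ : Equiv.Perm (Fin 4)) = Finset.univ ↔ F = Finset.univ := by
      rw [← Finset.card_eq_iff_eq_univ, ← Finset.card_eq_iff_eq_univ,
        Finset.card_image_of_injective _ (Equiv.injective _)]
    simp only [mact, Pi.single_apply, hiff]
  · intro b hb
    exact Subtype.ext (fixed_eq_single M g hg k b hb)

end SimpleFlatMatroid

open SimpleFlatMatroid in
/-- Let `M` be the Boolean matroid of rank `4` on `E = {1,2,3,4}` (every subset is a flat
and `rk F = |F|`), so `G = Aut(M) = S₄` and `r = 3`, and let `g ∈ S₄` be a 4-cycle.  Then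
each of the `G`-sets `FY¹, FY², FY³` has exactly one `g`-fixed point, so
`FY¹ × FY¹ × FY²` has exactly one `g`-fixed point while `(FY¹ × FY³) ⊔ (FY² × FY²)` has
exactly two; consequently there is no `S₄`-equivariant injection
`(FY¹ × FY³) ⊔ (FY² × FY²) → FY¹ × FY¹ × FY²`.  In particular `(FY⁰, FY¹, FY², FY³)` is
not Burnside `PF₃`. -/
theorem boolean_rank4_not_burnside_pf3
    (M : SimpleFlatMatroid (Fin 4))
    (hflats : M.flats = Finset.univ)
    (hrank : ∀ F : Finset (Fin 4), M.rk F = F.card)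
    (g : Equiv.Perm (Fin 4)) (hg : g.IsCycle ∧ g.support = Finset.univ) :
    (∃! a : M.FYk 1, rel1 g a a) ∧
    (∃! a : M.FYk 2, rel1 g a a) ∧
    (∃! a : M.FYk 3, rel1 g a a) ∧
    Nat.card {x : M.FYk 1 × M.FYk 1 × M.FYk 2 // rel3 g x x} = 1 ∧
    Nat.card {x : (M.FYk 1 × M.FYk 3) ⊕ (M.FYk 2 × M.FYk 2) //
        relSum (rel2 g) (rel2 g) x x} = 2 ∧
    ¬ ∃ φ : (M.FYk 1 × M.FYk 3) ⊕ (M.FYk 2 × M.FYk 2) → M.FYk 1 × M.FYk 1 × M.FYk 2,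
        Function.Injective φ ∧
        ∀ g' : Equiv.Perm (Fin 4),
          ∀ x y : (M.FYk 1 × M.FYk 3) ⊕ (M.FYk 2 × M.FYk 2),
            relSum (rel2 g') (rel2 g') x y → rel3 g' (φ x) (φ y) := by
  obtain ⟨a1, f1, u1⟩ := existsUnique_fixed M hflats hrank g hg 1 (by norm_num)
  obtain ⟨a2, f2, u2⟩ := existsUnique_fixed M hflats hrank g hg 2 (by norm_num)
  obtain ⟨a3, f3, u3⟩ := existsUnique_fixed M hflats hrank g hg 3 (by norm_num)
  have h3 : ∀ x : M.FYk 1 × M.FYk 1 × M.FYk 2, rel3 g x x → x = (a1, a1, a2) := by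
    rintro ⟨x, y, z⟩ ⟨hx, hy, hz⟩
    rw [u1 x hx, u1 y hy, u2 z hz]
  refine ⟨⟨a1, f1, u1⟩, ⟨a2, f2, u2⟩, ⟨a3, f3, u3⟩, ?_, ?_, ?_⟩
  · rw [Nat.card_eq_one_iff_exists]
    exact ⟨⟨(a1, a1, a2), f1, f1, f2⟩, fun x => Subtype.ext (h3 x.1 x.2)⟩
  · rw [Nat.card_eq_two_iff]
    refine ⟨⟨Sum.inl (a1, a3), f1, f3⟩, ⟨Sum.inr (a2, a2), f2, f2⟩, ?_, ?_⟩
    · intro h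
      exact Sum.inl_ne_inr (congrArg Subtype.val h)
    · refine Set.eq_univ_of_forall ?_
      rintro ⟨⟨x, y⟩ | ⟨x, y⟩, hx, hy⟩
      · left
        apply Subtype.ext
        change Sum.inl (x, y) = Sum.inl (a1, a3)
        rw [u1 x hx, u3 y hy]
      · right
        apply Subtype.ext
        change Sum.inr (x, y) = Sum.inr (a2, a2)
        rw [u2 x hx, u2 y hy]
  · rintro ⟨φ, hinj, heq⟩
    have e1 := h3 _ (heq g (Sum.inl (a1, a3)) (Sum.inl (a1, a3)) ⟨f1, f3⟩)
    have e2 := h3 _ (heq g (Sum.inr (a2, a2)) (Sum.inr (a2, a2)) ⟨f2, f2⟩)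
    exact Sum.inl_ne_inr (hinj (e1.trans e2.symm))
end
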